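/- arXiv:cond-mat/0003049 — 5 statements merged into one kernel-verified Lean document; each statement's English description precedes it below -/
import Mathlib

section
/- For any finite forest F, Z(F) = sum over all induced subtrees T' of F of L(T'), where L takes value 1 on the one-vertex tree and 2·(-1)^{n-1} on trees with n ≥ 2 vertices. -/
open Classical

/-- The dimension of the kernel of the adjacency matrix of `G` over `ℚ`. -/
noncomputable def kerDim {V : Type*} [Fintype V] [DecidableEq V] (G : SimpleGraph V) : ℕ :=
  Module.finrank ℚ (LinearMap.ker (Matrix.toLin' (G.adjMatrix ℚ)))

lemma kd_exists_leaf {V : Type*} [Fintype V] (F : SimpleGraph V) (hF : F.IsAcyclic)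
    {a b : V} (hab : F.Adj a b) : ∃ v u, F.Adj v u ∧ ∀ w, F.Adj v w → w = u := by
  let c := F.connectedComponentMk a
  have ht := hF.isTree_connectedComponent c
  have hb : b ∈ c.supp := by
    rw [SimpleGraph.ConnectedComponent.mem_supp_iff]
    exact SimpleGraph.ConnectedComponent.sound hab.symm.reachable
  have ha : a ∈ c.supp := by
    rw [SimpleGraph.ConnectedComponent.mem_supp_iff]
  have : Nontrivial c := ⟨⟨a, ha⟩, ⟨b, hb⟩, fun h => hab.ne (congrArg Subtype.val h)⟩
  obtain ⟨v, hv⟩ := ht.exists_vert_degree_one_of_nontrivial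
  obtain ⟨u, hu, hu2⟩ := SimpleGraph.degree_eq_one_iff_existsUnique_adj.mp hv
  refine ⟨v.1, u.1, hu, fun w hw => ?_⟩
  have hwc : w ∈ c.supp := by
    have h3 : F.connectedComponentMk v.1 = c := v.2
    rw [SimpleGraph.ConnectedComponent.mem_supp_iff, ← h3]
    exact SimpleGraph.ConnectedComponent.sound hw.symm.reachable
  exact congrArg Subtype.val (hu2 ⟨w, hwc⟩ hw)

lemma kd_reach {V W : Type*} {G : SimpleGraph V} {H : SimpleGraph W} (r : V → W)
    (h : ∀ a b, G.Adj a b → H.Reachable (r a) (r b)) {a b : V} (hab : G.Reachable a b) :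
    H.Reachable (r a) (r b) := by
  obtain ⟨p⟩ := hab
  induction p with
  | nil => exact SimpleGraph.Reachable.refl _
  | cons h1 _ ih => exact (h _ _ h1).trans ih

lemma kd_isolated {V : Type*} {G : SimpleGraph V} {u : V} (hu : ∀ w, ¬ G.Adj u w)
    {s : Finset V} (hs : u ∈ s) : (G.induce (↑s : Set V)).Connected ↔ s = {u} := by
  constructor
  · intro h
    ext w
    rw [Finset.mem_singleton]
    constructor
    · intro hw
      obtain ⟨p⟩ := h.preconnected ⟨u, hs⟩ ⟨w, hw⟩
      cases p with
      | nil => rfl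
      | cons h1 _ => exact absurd h1 (hu _)
    · rintro rfl; exact hs
  · rintro rfl
    have : Subsingleton (↑(({u} : Finset V)) : Set V) := by
      rw [Finset.coe_singleton]; infer_instance
    have : Nonempty (↑(({u} : Finset V)) : Set V) := ⟨⟨u, hs⟩⟩
    exact ⟨fun a b => by rw [Subsingleton.elim a b]⟩

lemma kd_leaf_conn {V : Type*} [DecidableEq V] {G : SimpleGraph V} {u v : V}
    (huv : G.Adj v u) (hl : ∀ w, G.Adj v w → w = u)
    {s : Finset V} (hs : u ∈ s) (hv : v ∉ s) :
    (G.induce (↑(insert v s) : Set V)).Connected ↔ (G.induce (↑s : Set V)).Connected := by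
  constructor
  · intro h
    have : Nonempty (↑s : Set V) := ⟨⟨u, hs⟩⟩
    refine ⟨?_⟩
    have hmem : ∀ x : (↑(insert v s) : Set V), x.1 ≠ v → x.1 ∈ (↑s : Set V) := by
      intro x hx
      have := x.2
      simp only [Finset.coe_insert, Set.mem_insert_iff] at this
      tauto
    let r : (↑(insert v s) : Set V) → (↑s : Set V) := fun x =>
      if hx : x.1 = v then ⟨u, hs⟩ else ⟨x.1, hmem x hx⟩
    have hr : ∀ x : (↑s : Set V), r ⟨x.1, by simp [x.2]⟩ = x := by
      intro x
      have : x.1 ≠ v := fun hx => hv (hx ▸ x.2)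
      simp [r, this]
    intro a b
    rw [← hr a, ← hr b]
    refine kd_reach r ?_ (h.preconnected _ _)
    intro x y hxy
    have hxy' : G.Adj x.1 y.1 := hxy
    by_cases hx : x.1 = v
    · by_cases hy : y.1 = v
      · exact absurd (hx.trans hy.symm) hxy'.ne
      · have : y.1 = u := hl _ (by have h5 := hxy'; simp only [hx] at h5; exact h5)
        have : r x = r y := by simp [r, hx, hy, this]
        rw [this]
    · by_cases hy : y.1 = v
      · have : x.1 = u := hl _ (by have h5 := hxy'.symm; simp only [hy] at h5; exact h5)
        have : r x = r y := by simp [r, hx, hy, this]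
        rw [this]
      · apply SimpleGraph.Adj.reachable
        simp only [r, hx, hy, dite_false]
        exact hxy'
  · intro h
    have hin : ∀ x : (↑s : Set V), x.1 ∈ (↑(insert v s) : Set V) := fun x => by simp [x.2]
    have key : ∀ x : (↑(insert v s) : Set V),
        (G.induce (↑(insert v s) : Set V)).Reachable x ⟨u, hin ⟨u, hs⟩⟩ := by
      intro x
      by_cases hx : x.1 = v
      · apply SimpleGraph.Adj.reachable
        change G.Adj x.1 u
        rw [hx]; exact huv
      · have hxs : x.1 ∈ (↑s : Set V) := by
          have := x.2
          simp only [Finset.coe_insert, Set.mem_insert_iff] at this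
          tauto
        exact kd_reach (fun y : (↑s : Set V) =>
          (⟨y.1, hin y⟩ : (↑(insert v s) : Set V)))
          (fun a b hab => SimpleGraph.Adj.reachable hab) (h.preconnected ⟨x.1, hxs⟩ ⟨u, hs⟩)
    have : Nonempty (↑(insert v s) : Set V) := ⟨⟨u, hin ⟨u, hs⟩⟩⟩
    exact ⟨fun a b => (key a).trans (key b).symm⟩

lemma kd_mem_ker {V : Type*} [Fintype V] [DecidableEq V] (G : SimpleGraph V) (x : V → ℚ) :
    x ∈ LinearMap.ker (Matrix.toLin' (G.adjMatrix ℚ)) ↔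
      ∀ w, ∑ z, (if G.Adj w z then x z else 0) = 0 := by
  rw [LinearMap.mem_ker, Matrix.toLin'_apply, funext_iff]
  simp [Matrix.mulVec, dotProduct, SimpleGraph.adjMatrix_apply]

lemma kd_kerDim_aux {V : Type*} [Fintype V] [DecidableEq V] (G H : SimpleGraph V) {u v : V}
    (huv : G.Adj v u) (hl : ∀ w, G.Adj v w → w = u)
    (hH : ∀ a b, H.Adj a b ↔ G.Adj a b ∧ a ≠ u ∧ b ≠ u) :
    kerDim H = kerDim G + 2 := by
  unfold kerDim
  set K' := LinearMap.ker (Matrix.toLin' (H.adjMatrix ℚ)) with hK'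
  set K := LinearMap.ker (Matrix.toLin' (G.adjMatrix ℚ)) with hK
  have hvrow : ∀ x : V → ℚ, ∑ z, (if G.Adj v z then x z else 0) = x u := by
    intro x
    rw [Finset.sum_eq_single u]
    · simp [huv]
    · intro b _ hb
      rw [if_neg]
      exact fun h => hb (hl _ h)
    · simp
  let φ : (V → ℚ) →ₗ[ℚ] ℚ × ℚ :=
    { toFun := fun x => (x u, ∑ z, (if G.Adj u z then x z else 0))
      map_add' := by
        intro x y
        ext
        · simp
        · simp [← Finset.sum_add_distrib]
          refine Finset.sum_congr rfl fun z _ => ?_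
          split_ifs <;> simp
      map_smul' := by
        intro c x
        ext
        · simp
        · simp [Finset.mul_sum] }
  have hφ : ∀ x, φ x = (x u, ∑ z, (if G.Adj u z then x z else 0)) := fun _ => rfl
  have hKK : K = K' ⊓ LinearMap.ker φ := by
    ext x
    rw [Submodule.mem_inf, LinearMap.mem_ker (f := φ), hφ, hK, hK', kd_mem_ker, kd_mem_ker,
      Prod.mk_eq_zero]
    have aux : x u = 0 → ∀ w, w ≠ u → ∑ z, (if H.Adj w z then x z else 0)
        = ∑ z, (if G.Adj w z then x z else 0) := by
      intro hx w hw
      refine Finset.sum_congr rfl fun z _ => ?_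
      rw [hH]
      by_cases hz : z = u
      · subst hz; simp [hx]
      · simp [hw, hz]
    constructor
    · intro h
      have hx : x u = 0 := by rw [← hvrow x, h]
      refine ⟨fun w => ?_, hx, h u⟩
      by_cases hw : w = u
      · subst hw; simp [hH]
      · rw [aux hx w hw, h]
    · rintro ⟨h, hx, h2⟩ w
      by_cases hw : w = u
      · subst hw; exact h2
      · rw [← aux hx w hw, h]
  have hne : v ≠ u := huv.ne
  have hsingle : ∀ t, (∀ w, ¬ H.Adj w t) → (Pi.single t (1 : ℚ) : V → ℚ) ∈ K' := by
    intro t ht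
    rw [hK', kd_mem_ker]
    intro w
    refine Finset.sum_eq_zero fun z _ => ?_
    by_cases hz : z = t
    · subst hz; rw [if_neg (ht w)]
    · simp [hz]
  have hu1 : (Pi.single u (1 : ℚ) : V → ℚ) ∈ K' := hsingle u fun w => by
    simp [hH]
  have hv1 : (Pi.single v (1 : ℚ) : V → ℚ) ∈ K' := hsingle v fun w => by
    rw [hH]
    rintro ⟨h1, h2, _⟩
    exact h2 (hl _ h1.symm)
  let ψ := φ.domRestrict K'
  have hsurj : Function.Surjective ψ := by
    rintro ⟨a, b⟩
    refine ⟨a • ⟨_, hu1⟩ + b • ⟨_, hv1⟩, ?_⟩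
    rw [map_add, map_smul, map_smul]
    have e1 : ψ ⟨_, hu1⟩ = (1, 0) := by
      change φ _ = _
      rw [hφ, Prod.mk.injEq]
      refine ⟨by simp, Finset.sum_eq_zero fun z _ => ?_⟩
      by_cases hz : z = u
      · subst hz; simp
      · simp [hz]
    have e2 : ψ ⟨_, hv1⟩ = (0, 1) := by
      change φ _ = _
      rw [hφ, Prod.mk.injEq]
      refine ⟨by simp [hne.symm], ?_⟩
      rw [Finset.sum_eq_single v]
      · simp [huv.symm]
      · intro z _ hz
        simp [hz]
      · simp
    rw [e1, e2]
    simp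
  have h1 := ψ.finrank_range_add_finrank_ker
  rw [LinearMap.range_eq_top.mpr hsurj, finrank_top, Module.finrank_prod, Module.finrank_self] at h1
  have h2 : Module.finrank ℚ (LinearMap.ker ψ) = Module.finrank ℚ K := by
    have : K = (LinearMap.ker ψ).map K'.subtype := by
      rw [hKK, LinearMap.ker_domRestrict, Submodule.map_comap_subtype]
    rw [this]
    exact (LinearEquiv.finrank_eq (Submodule.equivMapOfInjective _ K'.injective_subtype _))
  omega

lemma kd_kerDim {V : Type*} [Fintype V] [DecidableEq V] (G : SimpleGraph V) {u v : V}
    (huv : G.Adj v u) (hl : ∀ w, G.Adj v w → w = u) :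
    kerDim (G.deleteIncidenceSet u) = kerDim G + 2 :=
  kd_kerDim_aux G _ huv hl fun _ _ => SimpleGraph.deleteIncidenceSet_adj

noncomputable def kdTerm {V : Type*} (F : SimpleGraph V) (s : Finset V) : ℤ :=
  @ite ℤ (F.induce (↑s : Set V)).Connected (Classical.propDecidable _)
    (if s.card = 1 then 1 else 2 * (-1) ^ (s.card - 1)) 0

lemma kd_sum {V : Type*} [Fintype V] [DecidableEq V] (G : SimpleGraph V) {u v : V}
    (huv : G.Adj v u) (hl : ∀ w, G.Adj v w → w = u) :
    ∑ s : Finset V, kdTerm (G.deleteIncidenceSet u) s = ∑ s : Finset V, kdTerm G s + 2 := by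
  have hne : v ≠ u := huv.ne
  have split : ∀ f : Finset V → ℤ, ∑ s : Finset V, f s =
      ∑ s ∈ (Finset.univ.erase u).powerset, f s +
      ∑ s ∈ (Finset.univ.erase u).powerset, f (insert u s) := by
    intro f
    rw [← Finset.sum_powerset_insert (Finset.notMem_erase u _),
      Finset.insert_erase (Finset.mem_univ u), Finset.powerset_univ]
  rw [split, split (kdTerm G)]
  have hA : ∑ s ∈ (Finset.univ.erase u).powerset, kdTerm (G.deleteIncidenceSet u) s =
      ∑ s ∈ (Finset.univ.erase u).powerset, kdTerm G s := by
    refine Finset.sum_congr rfl fun s hs => ?_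
    have hus : u ∉ s := fun h => by simpa using Finset.mem_powerset.mp hs h
    unfold kdTerm
    rw [SimpleGraph.induce_deleteIncidenceSet_of_notMem G (s := (↑s : Set V)) (by simpa using hus)]
  have hB : ∑ s ∈ (Finset.univ.erase u).powerset, kdTerm (G.deleteIncidenceSet u) (insert u s)
      = 1 := by
    rw [Finset.sum_eq_single ∅]
    · have := (kd_isolated (G := G.deleteIncidenceSet u) (u := u)
        (by simp [SimpleGraph.deleteIncidenceSet_adj]) (s := insert u ∅) (by simp)).mpr (by simp)
      rw [kdTerm, if_pos this]
      simp
    · intro s hs hs0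
      have hus : u ∉ s := fun h => by simpa using Finset.mem_powerset.mp hs h
      rw [kdTerm, if_neg]
      rw [kd_isolated (u := u) (by simp [SimpleGraph.deleteIncidenceSet_adj]) (by simp)]
      intro h
      apply hs0
      rw [← Finset.erase_insert hus, h]
      simp
    · simp
  have hC : ∑ s ∈ (Finset.univ.erase u).powerset, kdTerm G (insert u s) = -1 := by
    have hv : v ∈ Finset.univ.erase u := by simp [hne]
    rw [← Finset.insert_erase hv, Finset.sum_powerset_insert (Finset.notMem_erase v _),
      ← Finset.sum_add_distrib, Finset.sum_eq_single ∅]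
    · have h1 : (G.induce (↑(insert u (∅ : Finset V)) : Set V)).Connected := by
        have : Subsingleton (↑(insert u (∅ : Finset V)) : Set V) := by
          rw [insert_empty_eq, Finset.coe_singleton]; infer_instance
        have : Nonempty (↑(insert u (∅ : Finset V)) : Set V) := ⟨⟨u, by simp⟩⟩
        exact ⟨fun a b => by rw [Subsingleton.elim a b]⟩
      have h2 := (kd_leaf_conn huv hl (s := insert u ∅) (by simp) (by simp [hne])).mpr h1
      rw [Finset.insert_comm u v, kdTerm, kdTerm, if_pos h1, if_pos h2]
      rw [Finset.card_insert_of_notMem (a := v) (by simp [hne])]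
      simp
    · intro s hs hs0
      have hus : u ∉ s := fun h => by simpa using Finset.mem_powerset.mp hs h
      have hvs : v ∉ s := fun h => by simpa using Finset.mem_powerset.mp hs h
      have hvs' : v ∉ insert u s := by simp [hne, hvs]
      have hpos : 0 < s.card := Finset.card_pos.mpr (Finset.nonempty_iff_ne_empty.mpr hs0)
      obtain ⟨n, hn⟩ : ∃ n, s.card = n + 1 := ⟨s.card - 1, by omega⟩
      rw [Finset.insert_comm u v, kdTerm, kdTerm, propext (kd_leaf_conn huv hl (by simp) hvs'),
        Finset.card_insert_of_notMem hvs', Finset.card_insert_of_notMem hus, hn]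
      split_ifs
      · omega
      · omega
      · omega
      · simp [pow_succ]
      · simp
    · simp
  rw [hA, hB, hC]
  ring

lemma kd_main {V : Type*} [Fintype V] [DecidableEq V] (n : ℕ) :
    ∀ F : SimpleGraph V, F.edgeSet.ncard = n → F.IsAcyclic →
    (kerDim F : ℤ) = ∑ s : Finset V, kdTerm F s := by
  induction n using Nat.strong_induction_on with
  | _ n ih =>
    intro F hn hF
    by_cases hbot : ∃ a b, F.Adj a b
    · obtain ⟨a, b, hab⟩ := hbot
      obtain ⟨v, u, huv, hl⟩ := kd_exists_leaf F hF hab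
      have hlt : (F.deleteIncidenceSet u).edgeSet.ncard < n := by
        rw [← hn]
        apply Set.ncard_lt_ncard _ (Set.toFinite _)
        rw [SimpleGraph.edgeSet_ssubset_edgeSet]
        refine lt_of_le_of_ne (F.deleteIncidenceSet_le u) fun h => ?_
        rw [← h, SimpleGraph.deleteIncidenceSet_adj] at huv
        exact huv.2.2 rfl
      have := ih _ hlt (F.deleteIncidenceSet u) rfl (hF.anti (F.deleteIncidenceSet_le u))
      rw [kd_sum F huv hl, kd_kerDim F huv hl] at this
      push_cast at this
      linarith
    · push Not at hbot
      have h1 : kerDim F = Fintype.card V := by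
        have : LinearMap.ker (Matrix.toLin' (F.adjMatrix ℚ)) = ⊤ := by
          rw [eq_top_iff]
          intro x _
          rw [kd_mem_ker]
          simp [hbot]
        rw [kerDim, this, finrank_top, Module.finrank_fintype_fun_eq_card]
      have h2 : ∀ s : Finset V, kdTerm F s = if s.card = 1 then 1 else 0 := by
        intro s
        rw [kdTerm]
        by_cases hs : s.card = 1
        · obtain ⟨u, rfl⟩ := Finset.card_eq_one.mp hs
          rw [if_pos ((kd_isolated (hbot u) (by simp)).mpr rfl), if_pos hs, if_pos hs]
        · rw [if_neg, if_neg hs]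
          intro hc
          obtain ⟨⟨u, hu⟩⟩ := hc.nonempty
          rw [kd_isolated (hbot u) hu] at hc
          exact hs (by rw [hc]; simp)
      simp_rw [h1, h2, Finset.sum_boole]
      have : (Finset.univ.filter fun s : Finset V => s.card = 1) =
          Finset.powersetCard 1 Finset.univ := by
        ext s; simp [Finset.mem_powersetCard]
      rw [this, Finset.card_powersetCard]
      simp

/-- For a finite forest `F`, the kernel dimension of the adjacency matrix equals the sum,
over all vertex subsets `s` inducing a subtree of `F` (since `F` is acyclic, induced
subgraphs are trees iff they are connected, connectedness including nonemptiness),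
of `L`, where `L = 1` on the one-vertex tree and `L = 2 * (-1)^(n-1)` on trees with
`n ≥ 2` vertices. -/
theorem kerDim_forest_eq_sum_L {V : Type*} [Fintype V] [DecidableEq V]
    (F : SimpleGraph V) (hF : F.IsAcyclic) :
    (kerDim F : ℤ) =
      ∑ s : Finset V, if (F.induce (↑s : Set V)).Connected then
        (if s.card = 1 then 1 else 2 * (-1) ^ (s.card - 1)) else 0 := by
  rw [kd_main _ F rfl hF]
  refine Finset.sum_congr rfl fun s _ => ?_
  unfold kdTerm
  split_ifs <;> rfl
end

section
/- Let z_n denote the sum over all labeled trees T on n vertices of the dimension of the kernel of the adjacency matrix of T. Then z_n = n^{n-1} - 2·∑_{m=2}^{n} (-1)^m n^{n-m} m^{m-2} binom(n-1, m-1). -/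
open Classical

set_option linter.unusedSectionVars false
section TreeKer
variable {V : Type*} [Fintype V] [DecidableEq V]

/-- `W` is nonempty and connected in `G`, in terms of cuts. -/
def Cn (G : SimpleGraph V) (W : Finset V) : Prop :=
  W.Nonempty ∧ ∀ A ⊆ W, A.Nonempty → A ≠ W → ∃ a ∈ A, ∃ b ∈ W, b ∉ A ∧ G.Adj a b

lemma Cn_mono {G G' : SimpleGraph V} {W : Finset V}
    (h : ∀ a ∈ W, ∀ b ∈ W, G.Adj a b → G'.Adj a b) (hc : Cn G W) : Cn G' W := by
  refine ⟨hc.1, fun A hA hne hAW => ?_⟩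
  obtain ⟨a, ha, b, hb, hbA, hab⟩ := hc.2 A hA hne hAW
  exact ⟨a, ha, b, hb, hbA, h a (hA ha) b hb hab⟩

lemma Cn_congr {G G' : SimpleGraph V} {W : Finset V}
    (h : ∀ a ∈ W, ∀ b ∈ W, (G.Adj a b ↔ G'.Adj a b)) : Cn G W ↔ Cn G' W :=
  ⟨Cn_mono fun a ha b hb => (h a ha b hb).1, Cn_mono fun a ha b hb => (h a ha b hb).2⟩

lemma Cn_leaf {G : SimpleGraph V} {l p : V} {S : Finset V} (hlp : G.Adj l p)
    (hu : ∀ q, G.Adj l q → q = p) (hp : p ∈ S) (hl : l ∉ S) :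
    Cn G (insert l S) ↔ Cn G S := by
  constructor
  · rintro ⟨-, h⟩
    refine ⟨⟨p, hp⟩, fun A hA hne hAS => ?_⟩
    have hlA : l ∉ A := fun h => hl (hA h)
    by_cases hpA : p ∈ A
    · obtain ⟨a, ha, b, hb, hbA, hab⟩ := h (insert l A) (Finset.insert_subset_insert l hA)
        (Finset.insert_nonempty _ _) (by
          intro h
          apply hAS
          rw [← Finset.erase_insert hlA, h, Finset.erase_insert hl])
      simp only [Finset.mem_insert, not_or] at ha hb hbA
      have hal : a ≠ l := by
        rintro rfl
        exact hbA.2 (hu b hab ▸ hpA)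
      exact ⟨a, ha.resolve_left hal, b, hb.resolve_left hbA.1, hbA.2, hab⟩
    · obtain ⟨a, ha, b, hb, hbA, hab⟩ := h A (hA.trans (Finset.subset_insert _ _)) hne (by
          rintro rfl
          exact hlA (Finset.mem_insert_self _ _))
      have hbl : b ≠ l := by
        rintro rfl
        exact hpA (hu a hab.symm ▸ ha)
      exact ⟨a, ha, b, Finset.mem_of_mem_insert_of_ne hb hbl, hbA, hab⟩
  · rintro ⟨-, h⟩
    refine ⟨Finset.insert_nonempty _ _, fun A hA hne hAS => ?_⟩
    by_cases h1 : A ∩ S = ∅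
    · have hAl : A = {l} := by
        apply Finset.eq_singleton_iff_nonempty_unique_mem.2 ⟨hne, fun x hx => ?_⟩
        rcases Finset.mem_insert.1 (hA hx) with h | h
        · exact h
        · have : x ∈ A ∩ S := Finset.mem_inter.2 ⟨hx, h⟩
          simp [h1] at this
      subst hAl
      exact ⟨l, by simp, p, by simp [hp], by simpa using hlp.ne', hlp⟩
    · by_cases h2 : A ∩ S = S
      · have hSA : S ⊆ A := by rw [← h2]; exact Finset.inter_subset_left
        have hlA : l ∉ A := by
          intro hlA
          exact hAS (Finset.Subset.antisymm hA (Finset.insert_subset hlA hSA))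
        exact ⟨p, hSA hp, l, by simp, hlA, hlp.symm⟩
      · obtain ⟨a, ha, b, hb, hbA, hab⟩ := h (A ∩ S) Finset.inter_subset_right
          (Finset.nonempty_iff_ne_empty.2 h1) h2
        refine ⟨a, (Finset.mem_inter.1 ha).1, b, Finset.mem_insert_of_mem hb, fun hb' => hbA ?_, hab⟩
        exact Finset.mem_inter.2 ⟨hb', hb⟩

lemma Cn_singleton (G : SimpleGraph V) (v : V) : Cn G {v} := by
  refine ⟨by simp, fun A hA hne hAS => ?_⟩
  exact absurd ((Finset.Nonempty.subset_singleton_iff hne).1 hA) hAS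

/-- If `p` has no neighbour then the only connected set containing it is a singleton. -/
lemma Cn_isolated {G : SimpleGraph V} {p : V} (hp : ∀ q, ¬ G.Adj p q) {S : Finset V}
    (hS : p ∈ S) : Cn G S ↔ S = {p} := by
  constructor
  · rintro ⟨-, h⟩
    by_contra hne
    obtain ⟨a, ha, b, -, -, hab⟩ := h {p} (by simpa using hS) (by simp) (fun h => hne h.symm)
    rw [Finset.mem_singleton] at ha
    exact hp b (ha ▸ hab)
  · rintro rfl
    exact Cn_singleton G p

lemma connected_iff_Cn (G : SimpleGraph V) : G.Connected ↔ Cn G Finset.univ := by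
  constructor
  · intro h
    refine ⟨?_, fun A _ hne hA => ?_⟩
    · have := h.nonempty
      exact Finset.univ_nonempty
    obtain ⟨a, ha⟩ := hne
    obtain ⟨b, hb⟩ : ∃ b, b ∉ A := by
      by_contra! hcon
      exact hA (Finset.eq_univ_iff_forall.2 hcon)
    obtain ⟨w⟩ := h.preconnected a b
    obtain ⟨d, -, hd1, hd2⟩ := w.exists_boundary_dart (A : Set V) ha hb
    exact ⟨d.fst, hd1, d.snd, by simp, hd2, d.adj⟩
  · rintro ⟨⟨v, -⟩, h⟩
    rw [SimpleGraph.connected_iff_exists_forall_reachable]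
    refine ⟨v, fun w => ?_⟩
    by_contra hw
    obtain ⟨a, ha, b, -, hb, hab⟩ := h (Finset.univ.filter fun x => G.Reachable v x)
      (Finset.subset_univ _) ⟨v, by simp⟩ (fun h => hw (by
        have := Finset.mem_univ w
        rw [← h] at this
        simpa using this))
    simp only [Finset.mem_filter, Finset.mem_univ, true_and] at ha hb
    exact hb (ha.trans hab.reachable)

/-- Delete all edges at `p`. -/
def delV (G : SimpleGraph V) (p : V) : SimpleGraph V where
  Adj a b := G.Adj a b ∧ a ≠ p ∧ b ≠ p
  symm := ⟨fun _ _ h => ⟨h.1.symm, h.2.2, h.2.1⟩⟩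
  loopless := ⟨fun _ h => h.1.ne rfl⟩

/-- Signed count of connected sets. -/
noncomputable def sgn (G : SimpleGraph V) : ℤ :=
  ∑ S : Finset V, if Cn G S then (-1 : ℤ) ^ S.card else 0

lemma sgn_del {G : SimpleGraph V} {l p : V} (hlp : G.Adj l p)
    (hu : ∀ q, G.Adj l q → q = p) : sgn G = sgn (delV G p) + 1 := by
  unfold sgn
  rw [← Finset.sum_filter_add_sum_filter_not Finset.univ (fun S : Finset V => p ∈ S),
    ← Finset.sum_filter_add_sum_filter_not Finset.univ (fun S : Finset V => p ∈ S)
      (fun S => if Cn (delV G p) S then _ else _)]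
  have h1 : ∑ S ∈ Finset.univ.filter (fun S : Finset V => p ∈ S),
      (if Cn G S then (-1 : ℤ) ^ S.card else 0) = 0 := by
    have hpl : p ≠ l := hlp.ne'
    have key : ∀ S : Finset V, p ∈ S → l ∉ S →
        (if Cn G S then (-1 : ℤ) ^ S.card else 0) +
        (if Cn G (insert l S) then (-1 : ℤ) ^ (insert l S).card else 0) = 0 := by
      intro S hS hl
      simp only [Cn_leaf hlp hu hS hl]
      rw [Finset.card_insert_of_notMem hl]
      split_ifs <;> ring
    refine Finset.sum_involution (fun S _ => if l ∈ S then S.erase l else insert l S) ?_ ?_ ?_ ?_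
    · intro S hS
      rw [Finset.mem_filter] at hS
      by_cases h : l ∈ S
      · rw [if_pos h]
        have := key (S.erase l) (Finset.mem_erase.2 ⟨hpl, hS.2⟩) (Finset.notMem_erase _ _)
        rw [Finset.insert_erase h] at this
        rw [add_comm]; exact this
      · rw [if_neg h]
        exact key S hS.2 h
    · intro S hS _ 
      split_ifs with h
      · intro h'
        rw [← h'] at h
        simp at h
      · intro h'
        exact h (h' ▸ Finset.mem_insert_self _ _)
    · intro S hS
      rw [Finset.mem_filter] at hS ⊢
      split_ifs <;> simp [hS.2, hpl]
    · intro S hS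
      by_cases h : l ∈ S <;> simp [h]
  have h2 : ∑ S ∈ Finset.univ.filter (fun S : Finset V => p ∈ S),
      (if Cn (delV G p) S then (-1 : ℤ) ^ S.card else 0) = -1 := by
    rw [Finset.sum_eq_single {p}]
    · simp [Cn_singleton]
    · intro S hS hne
      rw [Finset.mem_filter] at hS
      rw [if_neg]
      rw [Cn_isolated (G := delV G p) (fun q hq => hq.2.1 rfl) hS.2]
      exact hne
    · simp
  have h3 : ∑ S ∈ Finset.univ.filter (fun S : Finset V => ¬ p ∈ S),
      (if Cn G S then (-1 : ℤ) ^ S.card else 0) =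
      ∑ S ∈ Finset.univ.filter (fun S : Finset V => ¬ p ∈ S),
      (if Cn (delV G p) S then (-1 : ℤ) ^ S.card else 0) := by
    refine Finset.sum_congr rfl fun S hS => ?_
    rw [Finset.mem_filter] at hS
    have : Cn G S ↔ Cn (delV G p) S := Cn_congr fun a ha b hb => by
      simp only [delV]
      constructor
      · intro h
        exact ⟨h, fun h => hS.2 (h ▸ ha), fun h => hS.2 (h ▸ hb)⟩
      · exact fun h => h.1
    simp only [this]
  rw [h1, h2, h3]
  ring

lemma ker_del {G : SimpleGraph V} {l p : V} (hlp : G.Adj l p)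
    (hu : ∀ q, G.Adj l q → q = p) : kerDim (delV G p) = kerDim G + 2 := by
  have hA : ∀ (H : SimpleGraph V) (x : V → ℚ),
      x ∈ LinearMap.ker (Matrix.toLin' (H.adjMatrix ℚ)) ↔
        ∀ v, (∑ u, if H.Adj v u then x u else 0) = 0 := by
    intro H x
    rw [LinearMap.mem_ker, Matrix.toLin'_apply, funext_iff]
    simp [Matrix.mulVec, dotProduct, SimpleGraph.adjMatrix_apply]
  let K' := LinearMap.ker (Matrix.toLin' ((delV G p).adjMatrix ℚ))
  let K := LinearMap.ker (Matrix.toLin' (G.adjMatrix ℚ))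
  let φ0 : (V → ℚ) →ₗ[ℚ] (Fin 2 → ℚ) :=
    LinearMap.pi ![LinearMap.proj p, ∑ u, if G.Adj p u then LinearMap.proj u else 0]
  have hφ0 : ∀ x, φ0 x 0 = x p := fun x => by simp [φ0]
  have hφ1 : ∀ x, φ0 x 1 = ∑ u, if G.Adj p u then x u else 0 := fun x => by
    simp only [φ0, LinearMap.pi_apply, Matrix.cons_val_one, Matrix.cons_val_fin_one,
      LinearMap.sum_apply]
    refine Finset.sum_congr rfl fun u _ => ?_
    split_ifs <;> simp
  let φ : K' →ₗ[ℚ] (Fin 2 → ℚ) := φ0.domRestrict K'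
  have hsurj : Function.Surjective φ := by
    intro y
    let x : V → ℚ := fun v => if v = p then y 0 else if v = l then y 1 else 0
    have hx : x ∈ K' := by
      rw [hA]
      intro v
      refine Finset.sum_eq_zero fun u _ => ?_
      split_ifs with h
      · obtain ⟨h1, h2, h3⟩ := h
        have : u ≠ l := by
          rintro rfl
          exact h2 (hu v h1.symm)
        simp [x, h3, this]
      · rfl
    refine ⟨⟨x, hx⟩, ?_⟩
    ext i
    fin_cases i
    · change φ0 x 0 = y 0
      rw [hφ0]; simp [x]
    · change φ0 x 1 = y 1
      rw [hφ1, Finset.sum_eq_single l]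
      · simp [x, hlp.symm, hlp.ne]
      · intro u _ hul
        split_ifs with h
        · simp [x, hul, h.ne']
        · rfl
      · simp
  have hker : (LinearMap.ker φ).map K'.subtype = K := by
    ext x
    simp only [Submodule.mem_map, LinearMap.mem_ker, Submodule.subtype_apply, Subtype.exists,
      exists_and_right, exists_eq_right]
    constructor
    · rintro ⟨hx, h⟩
      have h0 : x p = 0 := (hφ0 x).symm.trans (congrFun h 0)
      have h1 : ∑ u, (if G.Adj p u then x u else 0) = 0 := (hφ1 x).symm.trans (congrFun h 1)
      rw [hA] at hx
      rw [hA]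
      intro v
      by_cases hv : v = p
      · rw [hv]; exact h1
      · refine Eq.trans ?_ (hx v)
        refine Finset.sum_congr rfl fun u _ => ?_
        by_cases hup : u = p
        · subst hup; simp [h0]
        · simp [delV, hv, hup]
    · intro hx
      rw [hA] at hx
      have h0 : x p = 0 := by
        have := hx l
        rw [Finset.sum_eq_single p] at this
        · simpa [hlp] using this
        · intro u _ hup
          rw [if_neg]
          exact fun h => hup (hu u h)
        · simp
      refine ⟨?_, ?_⟩
      · rw [hA]
        intro v
        by_cases hv : v = p
        · refine Finset.sum_eq_zero fun u _ => ?_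
          simp [delV, hv]
        · refine Eq.trans ?_ (hx v)
          refine Finset.sum_congr rfl fun u _ => ?_
          by_cases hup : u = p
          · subst hup; simp [h0]
          · simp [delV, hv, hup]
      · ext i
        fin_cases i
        · change φ0 x 0 = 0
          rw [hφ0, h0]
        · change φ0 x 1 = 0
          rw [hφ1, hx p]
  have h1 := LinearMap.finrank_range_add_finrank_ker φ
  rw [LinearMap.range_eq_top.2 hsurj, finrank_top, Module.finrank_fin_fun] at h1
  have h2 : Module.finrank ℚ (LinearMap.ker φ) = Module.finrank ℚ K := by
    rw [← hker]
    exact (Submodule.equivMapOfInjective K'.subtype K'.injective_subtype _).finrank_eq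
  change Module.finrank ℚ K' = Module.finrank ℚ K + 2
  omega

lemma acyclic_leaf {G : SimpleGraph V} (hG : G.IsAcyclic) (hne : G ≠ ⊥) :
    ∃ l p, G.Adj l p ∧ ∀ q, G.Adj l q → q = p := by
  obtain ⟨a, b, hab⟩ := SimpleGraph.ne_bot_iff_exists_adj.1 hne
  have hT := hG.isTree_connectedComponent (G.connectedComponentMk a)
  have : Nontrivial (G.connectedComponentMk a) := by
    refine ⟨⟨⟨a, rfl⟩, ⟨b, ?_⟩, ?_⟩⟩
    · exact SimpleGraph.ConnectedComponent.sound hab.symm.reachable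
    · intro h
      exact hab.ne (congrArg Subtype.val h)
  obtain ⟨v, hv⟩ := hT.exists_vert_degree_one_of_nontrivial
  rw [SimpleGraph.degree_eq_one_iff_existsUnique_adj] at hv
  obtain ⟨w, hw, hu⟩ := hv
  refine ⟨v.1, w.1, hw, fun q hq => ?_⟩
  have hq' : q ∈ (G.connectedComponentMk a).supp := by
    have := v.2
    exact (SimpleGraph.ConnectedComponent.mem_supp_congr_adj _ hq).1 this
  exact congrArg Subtype.val (hu ⟨q, hq'⟩ hq)

lemma sgn_bot : sgn (⊥ : SimpleGraph V) = - (Fintype.card V : ℤ) := by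
  unfold sgn
  have : ∀ S : Finset V, Cn (⊥ : SimpleGraph V) S ↔ S.card = 1 := by
    intro S
    constructor
    · intro h
      obtain ⟨v, hv⟩ := h.1
      rw [Cn_isolated (p := v) (by simp) hv] at h
      simp [h]
    · intro h
      obtain ⟨v, rfl⟩ := Finset.card_eq_one.1 h
      exact Cn_singleton _ v
  simp only [this]
  rw [← Finset.sum_filter]
  rw [Finset.sum_congr rfl (g := fun _ => (-1 : ℤ)) (by
    intro S hS
    rw [Finset.mem_filter] at hS
    simp [hS.2])]
  have h2 : (Finset.univ.filter fun S : Finset V => S.card = 1) = Finset.powersetCard 1 Finset.univ := by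
    ext S; simp [Finset.mem_powersetCard]
  rw [h2]
  simp [Finset.card_powersetCard]

lemma kerDim_bot : kerDim (⊥ : SimpleGraph V) = Fintype.card V := by
  have h : ∀ M : Matrix V V ℚ, M = 0 →
      Module.finrank ℚ (LinearMap.ker (Matrix.toLin' M)) = Fintype.card V := by
    rintro M rfl
    rw [map_zero, LinearMap.ker_zero, finrank_top, Module.finrank_fintype_fun_eq_card]
  exact h _ (by ext i j; simp [SimpleGraph.adjMatrix_apply])

theorem kerDim_eq : ∀ (k : ℕ) (G : SimpleGraph V), G.edgeFinset.card ≤ k → G.IsAcyclic →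
    (kerDim G : ℤ) = - (Fintype.card V : ℤ) - 2 * sgn G := by
  intro k
  induction k with
  | zero =>
    intro G hk hG
    have : G = ⊥ := by
      rw [← SimpleGraph.edgeFinset_eq_empty, ← Finset.card_eq_zero]; omega
    subst this
    rw [kerDim_bot, sgn_bot]; ring
  | succ k ih =>
    intro G hk hG
    by_cases hne : G = ⊥
    · subst hne
      rw [kerDim_bot, sgn_bot]; ring
    obtain ⟨l, p, hlp, hu⟩ := acyclic_leaf hG hne
    have hle : delV G p ≤ G := fun a b h => h.1
    have hlt : delV G p < G := lt_of_le_of_ne hle (by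
      intro h
      have : (delV G p).Adj l p := by rw [h]; exact hlp
      exact this.2.2 rfl)
    have hc := Finset.card_lt_card (SimpleGraph.edgeFinset_ssubset_edgeFinset.2 hlt)
    have := ih (delV G p) (by omega) (hG.anti hle)
    rw [ker_del hlp hu] at this
    rw [sgn_del hlp hu]
    push_cast at this
    linarith

/-- Number of ordered adjacent pairs. -/
noncomputable def ecount (G : SimpleGraph V) (A B : Finset V) : ℕ :=
  ∑ a ∈ A, ∑ b ∈ B, if G.Adj a b then 1 else 0

/-- `l` is a leaf. -/
def Lf (G : SimpleGraph V) (l : V) : Prop := ∃ p, G.Adj l p ∧ ∀ q, G.Adj l q → q = p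

/-- `G` is a tree with vertex set `W`. -/
def IsTr (G : SimpleGraph V) (W : Finset V) : Prop :=
  (∀ a b, G.Adj a b → a ∈ W) ∧ Cn G W ∧ ecount G Finset.univ Finset.univ + 2 = 2 * W.card

lemma isTree_iff_IsTr (G : SimpleGraph V) : G.IsTree ↔ IsTr G Finset.univ := by
  rw [SimpleGraph.isTree_iff_connected_and_card, connected_iff_Cn, IsTr]
  have h : ecount G Finset.univ Finset.univ = 2 * Nat.card G.edgeSet := by
    rw [Nat.card_eq_fintype_card, ← SimpleGraph.edgeFinset_card,
      ← SimpleGraph.sum_degrees_eq_twice_card_edges]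
    unfold ecount
    refine Finset.sum_congr rfl fun a _ => ?_
    rw [← SimpleGraph.card_neighborFinset_eq_degree, SimpleGraph.neighborFinset_eq_filter]
    simp
  rw [h, Finset.card_univ, Nat.card_eq_fintype_card (α := V)]
  constructor
  · rintro ⟨h1, h2⟩
    exact ⟨fun _ _ _ => Finset.mem_univ _, h1, by omega⟩
  · rintro ⟨-, h1, h2⟩
    exact ⟨h1, by omega⟩

lemma ecount_ge {G : SimpleGraph V} {S : Finset V} (h : Cn G S) :
    2 * S.card ≤ ecount G S S + 2 := by
  have key : ∀ k, 1 ≤ k → k ≤ S.card → ∃ A ⊆ S, A.card = k ∧ 2 * k ≤ ecount G A A + 2 := by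
    intro k hk
    induction k, hk using Nat.le_induction with
    | base =>
      intro _
      obtain ⟨v, hv⟩ := h.1
      exact ⟨{v}, by simpa using hv, by simp, by omega⟩
    | succ k hk ih =>
      intro hkS
      obtain ⟨A, hAS, hA, hc⟩ := ih (by omega)
      obtain ⟨a, ha, b, hb, hbA, hab⟩ := h.2 A hAS (Finset.card_pos.1 (by omega))
        (by rintro rfl; omega)
      refine ⟨insert b A, Finset.insert_subset hb hAS, by
        rw [Finset.card_insert_of_notMem hbA, hA], ?_⟩
      have h1 : ecount G (insert b A) (insert b A) = ecount G A A +
          (∑ x ∈ A, if G.Adj x b then 1 else 0) + (∑ x ∈ A, if G.Adj b x then 1 else 0) := by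
        unfold ecount
        rw [Finset.sum_insert hbA]
        simp_rw [Finset.sum_insert hbA]
        rw [Finset.sum_add_distrib]
        simp
        ring
      have h2 : 1 ≤ ∑ x ∈ A, if G.Adj x b then 1 else 0 := by
        have := Finset.single_le_sum (f := fun x => if G.Adj x b then 1 else 0)
          (fun i _ => Nat.zero_le _) ha
        simpa [hab] using this
      have h3 : 1 ≤ ∑ x ∈ A, if G.Adj b x then 1 else 0 := by
        have := Finset.single_le_sum (f := fun x => if G.Adj b x then 1 else 0)
          (fun i _ => Nat.zero_le _) ha
        simpa [hab.symm] using this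
      omega
  obtain ⟨A, hAS, hA, hc⟩ := key S.card (Finset.card_pos.2 h.1) le_rfl
  rw [Finset.eq_of_subset_of_card_le hAS hA.ge] at hc
  exact hc

lemma leaf_exists {G : SimpleGraph V} {W S : Finset V} (hG : IsTr G W) (hS : Cn G S)
    (hSW : S ⊂ W) : ∃ l ∈ W \ S, Lf G l := by
  by_contra! hno
  obtain ⟨-, hW, he⟩ := hG
  have hdeg : ∀ v ∈ W \ S, 2 ≤ ∑ b, if G.Adj v b then 1 else 0 := by
    intro v hv
    rw [Finset.mem_sdiff] at hv
    obtain ⟨s, hs⟩ := hS.1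
    obtain ⟨a, ha, b, -, -, hab⟩ := hW.2 {v} (by simpa using hv.1) (by simp) (by
      intro h
      have : s ∈ ({v} : Finset V) := h ▸ hSW.1 hs
      rw [Finset.mem_singleton] at this
      exact hv.2 (this ▸ hs))
    rw [Finset.mem_singleton] at ha
    subst ha
    have hl := hno a (Finset.mem_sdiff.2 hv)
    unfold Lf at hl
    push Not at hl
    obtain ⟨q, hq, hqb⟩ := hl b hab
    have := Finset.sum_le_sum_of_subset (f := fun b => if G.Adj a b then 1 else 0)
      (Finset.subset_univ {q, b})
    rw [Finset.sum_pair hqb] at this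
    simpa [hq, hab] using this
  have h1 : 2 * S.card ≤ (∑ a ∈ S, ∑ b, if G.Adj a b then 1 else 0) + 1 := by
    have hge := ecount_ge hS
    obtain ⟨a, ha, b, hb, hbS, hab⟩ := hW.2 S hSW.1 hS.1 hSW.ne
    have h2 : ∀ a, (∑ b, if G.Adj a b then 1 else 0) = (∑ b ∈ S, if G.Adj a b then 1 else 0) +
        ∑ b ∈ Sᶜ, if G.Adj a b then 1 else 0 := fun a => (Finset.sum_add_sum_compl _ _).symm
    simp_rw [h2]
    rw [Finset.sum_add_distrib]
    have h3 : 1 ≤ ∑ a ∈ S, ∑ b ∈ Sᶜ, if G.Adj a b then 1 else 0 := by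
      have t1 := Finset.single_le_sum (f := fun a => ∑ b ∈ Sᶜ, if G.Adj a b then 1 else 0)
        (fun i _ => Nat.zero_le _) ha
      have t2 := Finset.single_le_sum (f := fun b => if G.Adj a b then 1 else 0)
        (fun i _ => Nat.zero_le _) (Finset.mem_compl.2 hbS)
      simp only [hab, if_true] at t2
      exact t2.trans t1
    unfold ecount at hge
    omega
  have h4 : (W \ S).card * 2 ≤ ∑ a ∈ W \ S, ∑ b, if G.Adj a b then 1 else 0 := by
    have := Finset.card_nsmul_le_sum _ _ _ hdeg
    simpa using this
  have h5 := Finset.sum_sdiff (f := fun a => ∑ b, if G.Adj a b then 1 else 0) hSW.1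
  have h6 := Finset.sum_le_sum_of_subset (f := fun a => ∑ b, if G.Adj a b then 1 else 0)
      (Finset.subset_univ W)
  have h7 := Finset.card_sdiff_add_card_eq_card hSW.1
  unfold ecount at he
  omega

/-- Add the edge `l p`. -/
def addE (G : SimpleGraph V) (l p : V) : SimpleGraph V where
  Adj a b := G.Adj a b ∨ (l ≠ p ∧ ((a = l ∧ b = p) ∨ (a = p ∧ b = l)))
  symm := ⟨fun _ _ h => by
    rcases h with h | ⟨h, h' | h'⟩
    · exact Or.inl h.symm
    · exact Or.inr ⟨h, Or.inr ⟨h'.2, h'.1⟩⟩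
    · exact Or.inr ⟨h, Or.inl ⟨h'.2, h'.1⟩⟩⟩
  loopless := ⟨fun _ h => by
    rcases h with h | ⟨h, h' | h'⟩
    · exact h.ne rfl
    · exact h (h'.1.symm.trans h'.2)
    · exact h (h'.2.symm.trans h'.1)⟩

lemma ecount_addE {G : SimpleGraph V} {l p : V} (hl : ∀ q, ¬ G.Adj l q) (hlp : l ≠ p) :
    ecount (addE G l p) Finset.univ Finset.univ = ecount G Finset.univ Finset.univ + 2 := by
  have h : ∀ a b, (if (addE G l p).Adj a b then 1 else 0) =
      (if G.Adj a b then 1 else 0) + ((if a = l then (if b = p then 1 else 0) else 0) +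
        (if a = p then (if b = l then 1 else 0) else 0)) := by
    intro a b
    have hl' : ∀ q, ¬ G.Adj q l := fun q h => hl q h.symm
    by_cases h1 : a = l
    · subst h1
      by_cases h2 : b = p <;> simp [addE, hl, hlp, h2]
    · by_cases h2 : a = p
      · subst h2
        by_cases h3 : b = l
        · subst h3; simp [addE, hl', hlp, hlp.symm]
        · simp [addE, hlp, h1, h3]
      · simp [addE, h1, h2]
  unfold ecount
  simp_rw [h, Finset.sum_add_distrib]
  congr 1
  have e1 : ∀ x y : V, (∑ a : V, ∑ b : V, if a = x then (if b = y then 1 else 0) else 0) = 1 := by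
    intro x y
    rw [Finset.sum_eq_single x]
    · simp
    · intro a _ ha; simp [ha]
    · simp
  rw [e1, e1]

lemma IsTr_addE {G : SimpleGraph V} {l p : V} {W : Finset V} (hl : ∀ q, ¬ G.Adj l q) (hlp : l ≠ p)
    (hlW : l ∈ W) (hpW : p ∈ W) (hsupp : ∀ a b, G.Adj a b → a ∈ W.erase l) :
    IsTr (addE G l p) W ↔ IsTr G (W.erase l) := by
  have hc : Cn (addE G l p) W ↔ Cn G (W.erase l) := by
    conv_lhs => rw [← Finset.insert_erase hlW]
    rw [Cn_leaf (l := l) (p := p)]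
    · apply Cn_congr
      intro a ha b hb
      have ha' := Finset.ne_of_mem_erase ha
      have hb' := Finset.ne_of_mem_erase hb
      simp [addE, ha', hb']
    · exact Or.inr ⟨hlp, Or.inl ⟨rfl, rfl⟩⟩
    · rintro q (h | ⟨-, h | h⟩)
      · exact absurd h (hl q)
      · exact h.2
      · exact absurd h.1 hlp
    · exact Finset.mem_erase.2 ⟨hlp.symm, hpW⟩
    · exact Finset.notMem_erase _ _
  unfold IsTr
  rw [hc, ecount_addE hl hlp]
  have hcard := Finset.card_erase_add_one hlW
  constructor
  · rintro ⟨-, h2, h3⟩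
    exact ⟨hsupp, h2, by omega⟩
  · rintro ⟨-, h2, h3⟩
    refine ⟨?_, h2, by omega⟩
    rintro a b (h | ⟨-, h | h⟩)
    · exact Finset.mem_of_mem_erase (hsupp a b h)
    · exact h.1 ▸ hlW
    · exact h.1 ▸ hpW

/-- Trees on `W` with `S` connected and all of `L` leaves. -/
noncomputable def aSet (W S L : Finset V) : Finset (SimpleGraph V) :=
  Finset.univ.filter fun G => IsTr G W ∧ Cn G S ∧ ∀ l ∈ L, Lf G l

lemma aSet_insert {W S L : Finset V} {l : V} (hS : S.Nonempty) (hSW : S ⊆ W) (hlW : l ∈ W)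
    (hlS : l ∉ S) (hlL : l ∉ L) (hL : L ⊆ W \ S) :
    (aSet W S (insert l L)).card = (W.card - L.card - 1) * (aSet (W.erase l) S L).card := by
  have hLW : L ⊆ W.erase l := fun x hx =>
    Finset.mem_erase.2 ⟨fun h => hlL (h ▸ hx), (Finset.mem_sdiff.1 (hL hx)).1⟩
  have hcard : (W.card - L.card - 1) = ((W.erase l) \ L).card := by
    rw [Finset.card_sdiff_of_subset hLW, Finset.card_erase_of_mem hlW]; omega
  rw [hcard, ← Finset.card_product]
  symm
  have hS_iff : ∀ (G : SimpleGraph V) (p : V), Cn (addE G l p) S ↔ Cn G S := by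
    intro G p
    apply Cn_congr
    intro a ha b hb
    have ha' : a ≠ l := fun h => hlS (h ▸ ha)
    have hb' : b ≠ l := fun h => hlS (h ▸ hb)
    simp [addE, ha', hb']
  refine Finset.card_bij (fun x _ => addE x.2 l x.1) ?_ ?_ ?_
  · rintro ⟨p, G⟩ hx
    simp only [Finset.mem_product, Finset.mem_sdiff, Finset.mem_erase, aSet, Finset.mem_filter,
      Finset.mem_univ, true_and] at hx ⊢
    obtain ⟨⟨⟨hpl, hpW⟩, hpL⟩, hT, hCS, hlf⟩ := hx
    have hl : ∀ q, ¬ G.Adj l q := fun q h => Finset.notMem_erase l W (hT.1 _ _ h)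
    refine ⟨(IsTr_addE hl hpl.symm hlW hpW hT.1).2 hT, (hS_iff G p).2 hCS, ?_⟩
    intro l' hl'
    rcases Finset.mem_insert.1 hl' with rfl | hl'
    · refine ⟨p, Or.inr ⟨hpl.symm, Or.inl ⟨rfl, rfl⟩⟩, ?_⟩
      rintro q (h | ⟨-, h | h⟩)
      · exact absurd h (hl q)
      · exact h.2
      · exact absurd h.1.symm hpl
    · obtain ⟨p', hp', hu⟩ := hlf l' hl'
      refine ⟨p', Or.inl hp', ?_⟩
      rintro q (h | ⟨-, h | h⟩)
      · exact hu q h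
      · exact absurd (h.1 ▸ hl') hlL
      · exact absurd (h.1 ▸ hl') hpL
  · rintro ⟨p, G⟩ hx ⟨p', G'⟩ hx' heq
    simp only [Finset.mem_product, Finset.mem_sdiff, Finset.mem_erase, aSet, Finset.mem_filter,
      Finset.mem_univ, true_and] at hx hx' heq
    have hl : ∀ q, ¬ G.Adj l q := fun q h => Finset.notMem_erase l W (hx.2.1.1 _ _ h)
    have hl' : ∀ q, ¬ G'.Adj l q := fun q h => Finset.notMem_erase l W (hx'.2.1.1 _ _ h)
    have hadj : ∀ a b, (addE G l p).Adj a b ↔ (addE G' l p').Adj a b := fun a b => by rw [heq]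
    have hpp : p = p' := by
      rcases (hadj l p).1 (Or.inr ⟨hx.1.1.1.symm, Or.inl ⟨rfl, rfl⟩⟩) with h | ⟨-, h | h⟩
      · exact absurd h (hl' _)
      · exact h.2
      · exact absurd h.1.symm hx'.1.1.1
    subst hpp
    have hGG : G = G' := by
      ext a b
      by_cases ha : a = l
      · subst ha; simp [hl, hl']
      by_cases hb : b = l
      · subst hb
        exact ⟨fun h => absurd h.symm (hl _), fun h => absurd h.symm (hl' _)⟩
      have := hadj a b
      simpa [addE, ha, hb] using this
    rw [hGG]
  · intro G hG
    simp only [aSet, Finset.mem_filter, Finset.mem_univ, true_and] at hG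
    obtain ⟨hT, hCS, hlf⟩ := hG
    obtain ⟨p, hlp, hu⟩ := hlf l (Finset.mem_insert_self _ _)
    have hpW : p ∈ W := hT.1 _ _ hlp.symm
    have hpL : p ∉ L := by
      intro hpL
      obtain ⟨r, hr, hu'⟩ := hlf p (Finset.mem_insert_of_mem hpL)
      have hrl : l = r := hu' l hlp.symm
      subst hrl
      obtain ⟨s, hs⟩ := hS
      obtain ⟨a, ha, b, -, hb, hab⟩ := hT.2.1.2 {l, p} (by
          intro x hx
          simp only [Finset.mem_insert, Finset.mem_singleton] at hx
          rcases hx with rfl | rfl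
          · exact hlW
          · exact hpW) (by simp) (by
          intro h
          have : s ∈ ({l, p} : Finset V) := h ▸ hSW hs
          simp only [Finset.mem_insert, Finset.mem_singleton] at this
          rcases this with rfl | rfl
          · exact hlS hs
          · exact (Finset.mem_sdiff.1 (hL hpL)).2 hs)
      simp only [Finset.mem_insert, Finset.mem_singleton, not_or] at ha hb
      rcases ha with rfl | rfl
      · exact hb.2 (hu b hab)
      · exact hb.1 (hu' b hab)
    have hGe : addE (delV G l) l p = G := by
      ext a b
      constructor
      · rintro (h | ⟨-, h | h⟩)
        · exact h.1
        · rw [h.1, h.2]; exact hlp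
        · rw [h.1, h.2]; exact hlp.symm
      · intro h
        by_cases ha : a = l
        · subst ha
          exact Or.inr ⟨hlp.ne, Or.inl ⟨rfl, hu b h⟩⟩
        by_cases hb : b = l
        · subst hb
          exact Or.inr ⟨hlp.ne, Or.inr ⟨hu a h.symm, rfl⟩⟩
        exact Or.inl ⟨h, ha, hb⟩
    refine ⟨(p, delV G l), ?_, hGe⟩
    simp only [Finset.mem_product, Finset.mem_sdiff, Finset.mem_erase, aSet, Finset.mem_filter,
      Finset.mem_univ, true_and]
    refine ⟨⟨⟨hlp.ne', hpW⟩, hpL⟩, ?_, ?_, ?_⟩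
    · rw [← IsTr_addE (G := delV G l) (p := p) (fun q h => h.2.1 rfl) hlp.ne hlW hpW, hGe]
      · exact hT
      · intro a b h
        exact Finset.mem_erase.2 ⟨h.2.1, hT.1 _ _ h.1⟩
    · rw [← hS_iff _ p, hGe]; exact hCS
    · intro l' hl'
      obtain ⟨p', hp', hu'⟩ := hlf l' (Finset.mem_insert_of_mem hl')
      refine ⟨p', ⟨hp', fun h => hlL (h ▸ hl'), ?_⟩, fun q hq => hu' q hq.1⟩
      rintro rfl
      exact hpL (hu l' hp'.symm ▸ hl')

lemma aSet_card {S : Finset V} (hS : S.Nonempty) : ∀ (L W : Finset V), S ⊆ W → L ⊆ W \ S →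
    (aSet W S L).card = (W.card - L.card) ^ L.card * (aSet (W \ L) S ∅).card := by
  intro L
  induction L using Finset.induction_on with
  | empty => intro W _ _; simp
  | insert l L hl ih =>
    intro W hSW hL
    have hlWS := Finset.mem_sdiff.1 (hL (Finset.mem_insert_self l L))
    have hL' : L ⊆ W \ S := (Finset.subset_insert l L).trans hL
    rw [aSet_insert hS hSW hlWS.1 hlWS.2 hl hL', ih (W.erase l)]
    · rw [Finset.card_insert_of_notMem hl, Finset.card_erase_of_mem hlWS.1, pow_succ]
      have : W.erase l \ L = W \ insert l L := by
        ext x; simp only [Finset.mem_sdiff, Finset.mem_erase, Finset.mem_insert]; tauto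
      rw [this, show W.card - (L.card + 1) = W.card - L.card - 1 by omega,
        show W.card - 1 - L.card = W.card - L.card - 1 by omega]
      ring
    · intro x hx
      exact Finset.mem_erase.2 ⟨fun h => hlWS.2 (h ▸ hx), hSW hx⟩
    · intro x hx
      have := Finset.mem_sdiff.1 (hL' hx)
      exact Finset.mem_sdiff.2 ⟨Finset.mem_erase.2 ⟨fun h => hl (h ▸ hx), this.1⟩, this.2⟩

lemma incl_excl {W S : Finset V} (hSW : S ⊂ W) :
    ∑ L ∈ (W \ S).powerset, (-1 : ℤ) ^ L.card * ((aSet W S L).card : ℤ) = 0 := by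
  have h1 : ∀ L : Finset V, ((aSet W S L).card : ℤ) = ∑ G ∈ aSet W S ∅,
      if ∀ l ∈ L, Lf G l then 1 else 0 := by
    intro L
    rw [Finset.sum_boole]
    congr 2
    ext G
    simp [aSet, and_assoc]
  simp_rw [h1, Finset.mul_sum]
  rw [Finset.sum_comm]
  refine Finset.sum_eq_zero fun G hG => ?_
  simp only [aSet, Finset.mem_filter, Finset.mem_univ, true_and] at hG
  obtain ⟨l, hl, hlf⟩ := leaf_exists hG.1 hG.2.1 hSW
  have hne : ((W \ S).filter (fun l => Lf G l)).Nonempty := ⟨l, Finset.mem_filter.2 ⟨hl, hlf⟩⟩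
  refine Eq.trans ?_ (Finset.sum_powerset_neg_one_pow_card_of_nonempty hne)
  have : ((W \ S).filter (fun l => Lf G l)).powerset =
      (W \ S).powerset.filter (fun L => ∀ l ∈ L, Lf G l) := by
    ext L
    simp only [Finset.mem_powerset, Finset.mem_filter, Finset.subset_iff]
    constructor
    · intro h
      exact ⟨fun x hx => (h hx).1, fun x hx => (h hx).2⟩
    · intro h x hx
      exact ⟨h.1 hx, h.2 x hx⟩
  rw [this, Finset.sum_filter]
  refine Finset.sum_congr rfl fun L _ => ?_
  simp

lemma findiff (N d : ℕ) (hd : 1 ≤ d) (hN : d ≤ N) :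
    ∑ l ∈ Finset.range (d + 1), (d.choose l : ℤ) * ((-1) ^ l * ((N - l : ℕ) : ℤ) ^ (d - 1)) = 0 := by
  have h1 := congrFun (fwdDiff_iter_pow_eq_zero_of_lt (R := ℤ) (j := d - 1) (n := d) (by omega))
    ((N - d : ℕ) : ℤ)
  rw [fwdDiff_iter_eq_sum_shift] at h1
  rw [← Finset.sum_range_reflect]
  simp only [Pi.zero_apply] at h1
  rw [← h1]
  refine Finset.sum_congr rfl fun k hk => ?_
  rw [Finset.mem_range] at hk
  rw [show d + 1 - 1 - k = d - k by omega, Nat.choose_symm (by omega : k ≤ d),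
    show N - (d - k) = (N - d) + k by omega]
  simp
  ring

/-- The number of trees on `W` in which `S` is connected. -/
lemma tcount {S : Finset V} (hS : S.Nonempty) : ∀ (k : ℕ) (W : Finset V), W.card = k → S ⊂ W →
    ((aSet W S ∅).card : ℤ) =
      S.card * (aSet S S ∅).card * (W.card : ℤ) ^ (W.card - S.card - 1) := by
  intro k
  induction k using Nat.strong_induction_on with
  | _ k ih =>
  intro W hW hSW
  have hlt := Finset.card_lt_card hSW
  have hd : (W \ S).card = W.card - S.card := Finset.card_sdiff_of_subset hSW.1
  have hie := incl_excl hSW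
  have hfd := findiff W.card (W \ S).card (by omega) (by omega)
  have hfd2 : ∑ L ∈ (W \ S).powerset,
      ((-1 : ℤ) ^ L.card * ((W.card - L.card : ℕ) : ℤ) ^ ((W \ S).card - 1)) = 0 := by
    rw [Finset.sum_powerset_apply_card
      (fun l => (-1 : ℤ) ^ l * ((W.card - l : ℕ) : ℤ) ^ ((W \ S).card - 1)), ← hfd]
    simp
  have hmem : ∅ ∈ (W \ S).powerset := by simp
  rw [← Finset.add_sum_erase _ _ hmem] at hie hfd2
  have hrest : ∑ L ∈ (W \ S).powerset.erase ∅, (-1 : ℤ) ^ L.card * ((aSet W S L).card : ℤ) =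
      (S.card * (aSet S S ∅).card) * ∑ L ∈ (W \ S).powerset.erase ∅,
      ((-1 : ℤ) ^ L.card * ((W.card - L.card : ℕ) : ℤ) ^ ((W \ S).card - 1)) := by
    rw [Finset.mul_sum]
    refine Finset.sum_congr rfl fun L hL => ?_
    rw [Finset.mem_erase, Finset.mem_powerset] at hL
    obtain ⟨hne, hL⟩ := hL
    have hLpos : 0 < L.card := Finset.card_pos.2 (Finset.nonempty_iff_ne_empty.2 hne)
    rw [aSet_card hS L W hSW.1 hL]
    have hLW : L ⊆ W := hL.trans Finset.sdiff_subset
    have hc : (W \ L).card = W.card - L.card := Finset.card_sdiff_of_subset hLW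
    have hSL : S ⊆ W \ L := fun x hx =>
      Finset.mem_sdiff.2 ⟨hSW.1 hx, fun h => (Finset.mem_sdiff.1 (hL h)).2 hx⟩
    have hcl := Finset.card_le_card hL
    by_cases heq : S = W \ L
    · rw [← heq]
      have hSc : S.card = W.card - L.card := by rw [← hc, ← heq]
      have hLc : L.card = ((W \ S).card - 1) + 1 := by omega
      rw [← hSc]
      push_cast
      conv_lhs => rw [show (S.card : ℤ) ^ L.card = S.card * (S.card : ℤ) ^ ((W \ S).card - 1) by
        conv_lhs => rw [hLc]
        ring]
      ring
    · have hss : S ⊂ W \ L := lt_of_le_of_ne hSL heq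
      have hlt2 := Finset.card_lt_card hss
      push_cast
      rw [ih (W \ L).card (by omega) (W \ L) rfl hss, hc]
      rw [show (W \ S).card - 1 = L.card + (W.card - L.card - S.card - 1) by omega, pow_add]
      ring
  rw [hrest] at hie
  simp only [Finset.card_empty, pow_zero, one_mul, Nat.sub_zero, hd] at hie hfd2
  linear_combination hie - (S.card * (aSet S S ∅).card : ℤ) * hfd2

lemma tau_one (s : V) : (aSet ({s} : Finset V) {s} ∅).card = 1 := by
  rw [Finset.card_eq_one]
  refine ⟨⊥, ?_⟩
  ext G
  simp only [aSet, Finset.mem_filter, Finset.mem_univ, true_and, Finset.mem_singleton]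
  constructor
  · rintro ⟨h, -, -⟩
    ext a b
    simp only [SimpleGraph.bot_adj, iff_false]
    intro hab
    have h1 := h.1 a b hab
    have h2 := h.1 b a hab.symm
    rw [Finset.mem_singleton] at h1 h2
    exact hab.ne (h1.trans h2.symm)
  · rintro rfl
    exact ⟨⟨by simp, Cn_singleton _ _, by simp [ecount]⟩, Cn_singleton _ _, by simp⟩

lemma tau {S : Finset V} (h : 2 ≤ S.card) :
    ((aSet S S ∅).card : ℤ) = (S.card : ℤ) ^ (S.card - 2) := by
  obtain ⟨s, hs⟩ : S.Nonempty := Finset.card_pos.1 (by omega)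
  have hss : {s} ⊂ S := by
    refine lt_of_le_of_ne (by simpa using hs) ?_
    rintro rfl
    simp at h
  have := tcount (Finset.singleton_nonempty s) S.card S rfl hss
  rw [tau_one] at this
  have h2 : aSet S S ∅ = aSet S {s} ∅ := by
    ext G
    simp only [aSet, Finset.mem_filter, Finset.mem_univ, true_and, Cn_singleton]
    exact ⟨fun h => ⟨h.1, by simp⟩, fun h => ⟨h.1, h.1.2.1, by simp⟩⟩
  rw [h2, this]
  simp [Nat.sub_sub]

lemma tau_mul {S : Finset V} (h : S.Nonempty) :
    (S.card : ℤ) * ((aSet S S ∅).card : ℤ) = (S.card : ℤ) ^ (S.card - 1) := by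
  have h0 := Finset.card_pos.2 h
  by_cases h2 : 2 ≤ S.card
  · rw [tau h2, ← pow_succ']
    congr 1; omega
  · obtain ⟨s, rfl⟩ := Finset.card_eq_one.1 (show S.card = 1 by omega)
    rw [tau_one]; simp

/-- The number of trees in which a given set of size `m` is connected, times a sign. -/
noncomputable def fcount (n m : ℕ) : ℤ :=
  if m = 0 then 0 else (-1) ^ m *
    (if m < n then (m : ℤ) ^ (m - 1) * (n : ℤ) ^ (n - m - 1) else (n : ℤ) ^ (n - 2))

lemma fcount_eq (S : Finset V) :
    (-1 : ℤ) ^ S.card * ((aSet Finset.univ S ∅).card : ℤ) = fcount (Fintype.card V) S.card := by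
  unfold fcount
  by_cases h0 : S = ∅
  · subst h0
    have : aSet (Finset.univ : Finset V) ∅ ∅ = ∅ := by
      ext G
      simp [aSet, Cn]
    simp [this]
  have hne := Finset.nonempty_iff_ne_empty.2 h0
  have hpos := Finset.card_pos.2 hne
  rw [if_neg (by omega)]
  congr 1
  by_cases hu : S = Finset.univ
  · rw [if_neg (by simp [hu])]
    rw [hu, ← Finset.card_univ, ← hu]
    by_cases h2 : 2 ≤ S.card
    · exact tau h2
    · obtain ⟨s, rfl⟩ := Finset.card_eq_one.1 (show S.card = 1 by omega)
      rw [tau_one]; simp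
  · have hss : S ⊂ Finset.univ := lt_of_le_of_ne (Finset.subset_univ S) hu
    have hlt := Finset.card_lt_card hss
    rw [tcount hne _ _ rfl hss, tau_mul hne, Finset.card_univ, if_pos]
    rwa [Finset.card_univ] at hlt

lemma choose_fcount (n m : ℕ) (hm : 2 ≤ m) (hmn : m ≤ n) :
    (n.choose m : ℤ) * fcount n m =
      (-1 : ℤ) ^ m * (n : ℤ) ^ (n - m) * (m : ℤ) ^ (m - 2) * ((n - 1).choose (m - 1)) := by
  unfold fcount
  rw [if_neg (by omega)]
  obtain ⟨k, rfl⟩ : ∃ k, m = k + 2 := ⟨m - 2, by omega⟩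
  obtain ⟨N, rfl⟩ : ∃ N, n = N + 1 := ⟨n - 1, by omega⟩
  have hch : ((N + 1 : ℕ) : ℤ) * (N.choose (k + 1) : ℤ) =
      ((N + 1).choose (k + 2) : ℤ) * ((k + 2 : ℕ) : ℤ) := by
    exact_mod_cast Nat.add_one_mul_choose_eq N (k + 1)
  by_cases hlt : k + 2 < N + 1
  · rw [if_pos hlt]
    obtain ⟨j, hj⟩ : ∃ j, N + 1 - (k + 2) = j + 1 := ⟨N + 1 - (k + 2) - 1, by omega⟩
    rw [hj, show j + 1 - 1 = j by omega, show k + 2 - 1 = k + 1 by omega,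
      show k + 2 - 2 = k by omega, show N + 1 - 1 = N by omega]
    rw [pow_succ ((N + 1 : ℕ) : ℤ) j, pow_succ ((k + 2 : ℕ) : ℤ) k]
    linear_combination (-(-1 : ℤ) ^ (k + 2) * ((N + 1 : ℕ) : ℤ) ^ j * ((k + 2 : ℕ) : ℤ) ^ k) * hch
  · have : N + 1 = k + 2 := by omega
    rw [if_neg hlt]
    rw [this]
    simp

lemma sum_fcount (n : ℕ) (hn : 1 ≤ n) :
    ∑ m ∈ Finset.range (n + 1), (n.choose m : ℤ) * fcount n m =
      - (n : ℤ) ^ (n - 1) + ∑ m ∈ Finset.Icc 2 n,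
          (-1 : ℤ) ^ m * (n : ℤ) ^ (n - m) * (m : ℤ) ^ (m - 2) * ((n - 1).choose (m - 1)) := by
  have h1 : Finset.range (n + 1) = insert 0 (insert 1 (Finset.Icc 2 n)) := by
    ext x; simp only [Finset.mem_range, Finset.mem_insert, Finset.mem_Icc]; omega
  rw [h1, Finset.sum_insert (by simp), Finset.sum_insert (by simp)]
  have h2 : (n.choose 1 : ℤ) * fcount n 1 = - (n : ℤ) ^ (n - 1) := by
    unfold fcount
    by_cases h : 1 < n
    · obtain ⟨k, rfl⟩ : ∃ k, n = k + 2 := ⟨n - 2, by omega⟩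
      simp
      ring
    · have : n = 1 := by omega
      subst this
      simp
  rw [h2]
  have h3 : fcount n 0 = 0 := by simp [fcount]
  rw [h3, mul_zero, zero_add]
  congr 1
  refine Finset.sum_congr rfl fun m hm => ?_
  rw [Finset.mem_Icc] at hm
  exact choose_fcount n m hm.1 hm.2

lemma sum_sgn : ∑ G ∈ aSet (Finset.univ : Finset V) Finset.univ ∅, sgn G =
    ∑ m ∈ Finset.range (Fintype.card V + 1),
      ((Fintype.card V).choose m : ℤ) * fcount (Fintype.card V) m := by
  unfold sgn
  rw [Finset.sum_comm]
  have h : ∀ S : Finset V, (∑ G ∈ aSet (Finset.univ : Finset V) Finset.univ ∅,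
      if Cn G S then (-1 : ℤ) ^ S.card else 0) = fcount (Fintype.card V) S.card := by
    intro S
    rw [← fcount_eq, ← Finset.sum_filter, Finset.sum_const, nsmul_eq_mul, mul_comm]
    congr 3
    ext G
    simp only [aSet, Finset.mem_filter, Finset.mem_univ, true_and]
    exact ⟨fun h => ⟨h.1.1, h.2, by simp⟩, fun h => ⟨⟨h.1, h.1.2.1, by simp⟩, h.2.1⟩⟩
  simp_rw [h]
  rw [← Finset.powerset_univ, Finset.sum_powerset_apply_card (fun m => fcount (Fintype.card V) m),
    Finset.card_univ]
  simp

theorem main_aux (hV : 1 ≤ Fintype.card V) :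
    (∑ G : SimpleGraph V, if G.IsTree then (kerDim G : ℤ) else 0) =
      (Fintype.card V : ℤ) ^ (Fintype.card V - 1) -
        2 * ∑ m ∈ Finset.Icc 2 (Fintype.card V),
          (-1 : ℤ) ^ m * (Fintype.card V : ℤ) ^ (Fintype.card V - m) * (m : ℤ) ^ (m - 2) *
            ((Fintype.card V - 1).choose (m - 1)) := by
  rw [← Finset.sum_filter]
  have h1 : (Finset.univ.filter fun G : SimpleGraph V => G.IsTree) =
      aSet Finset.univ Finset.univ ∅ := by
    ext G
    simp only [aSet, Finset.mem_filter, Finset.mem_univ, true_and, isTree_iff_IsTr]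
    exact ⟨fun h => ⟨h, h.2.1, by simp⟩, fun h => h.1⟩
  have h2 : ∀ G ∈ Finset.univ.filter (fun G : SimpleGraph V => G.IsTree), (kerDim G : ℤ) =
      - (Fintype.card V : ℤ) - 2 * sgn G := by
    intro G hG
    rw [Finset.mem_filter] at hG
    exact kerDim_eq _ G le_rfl hG.2.isAcyclic
  rw [Finset.sum_congr rfl h2, h1, Finset.sum_sub_distrib, ← Finset.mul_sum, sum_sgn,
    sum_fcount _ hV, Finset.sum_const, nsmul_eq_mul]
  have hne : (Finset.univ : Finset V).Nonempty := Finset.card_pos.1 (by rwa [Finset.card_univ])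
  have h3 := tau_mul hne
  rw [Finset.card_univ] at h3
  linear_combination -h3

end TreeKer

/-- `z n`, the sum over all labeled trees on `n` vertices of the kernel dimension of
the adjacency matrix, equals
`n^(n-1) - 2 ∑_{m=2}^{n} (-1)^m n^(n-m) m^(m-2) choose (n-1) (m-1)`. -/
theorem total_kernel_multiplicity_closed_form (n : ℕ) (hn : 1 ≤ n) :
    (∑ G : SimpleGraph (Fin n), if G.IsTree then (kerDim G : ℤ) else 0) =
      (n : ℤ) ^ (n - 1) -
        2 * ∑ m ∈ Finset.Icc 2 n,
          (-1 : ℤ) ^ m * (n : ℤ) ^ (n - m) * (m : ℤ) ^ (m - 2) * ((n - 1).choose (m - 1)) := by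
  have h := main_aux (V := Fin n) (by simpa using hn)
  simp only [Fintype.card_fin] at h
  convert h using 3
end

section
/- With z_n as above, the expectation E(Z_n) = z_n / n^{n-2} satisfies E(Z_n) = n·(1 - 2·∑_{m=2}^{n} ((-1)^m / m) · (m/n)^m · binom(n, m)). -/
open Classical

set_option linter.unusedSectionVars false

section PartA
variable {V : Type*} [Fintype V] [DecidableEq V]

lemma toggle_connected (G : SimpleGraph V) (S : Finset V) (u v : V) (hu : u ∉ S) (hv : v ∈ S)
    (huv : G.Adj u v) (hl : ∀ w ∈ S, G.Adj u w → w = v) :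
    (G.induce (↑(insert u S) : Set V)).Connected ↔ (G.induce (↑S : Set V)).Connected := by
  have hvu : v ≠ u := fun h => hu (h ▸ hv)
  constructor
  · intro h
    have : Nonempty (↑S : Set V) := ⟨⟨v, hv⟩⟩
    refine ⟨fun x y => ?_⟩
    let f : (↑(insert u S) : Set V) → (↑S : Set V) := fun x =>
      if hx : x.1 = u then ⟨v, hv⟩ else ⟨x.1, by
        have := x.2
        simp only [Finset.coe_insert, Set.mem_insert_iff] at this
        tauto⟩
    have key : ∀ x y, (G.induce (↑(insert u S) : Set V)).Reachable x y →
        (G.induce (↑S : Set V)).Reachable (f x) (f y) := by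
      intro x y hxy
      rw [SimpleGraph.reachable_iff_reflTransGen] at hxy
      induction hxy with
      | refl => exact SimpleGraph.Reachable.refl _
      | @tail b c _ hbc ih =>
        refine ih.trans ?_
        have hadj : G.Adj b.1 c.1 := hbc
        have hb := b.2
        have hc := c.2
        simp only [Finset.coe_insert, Set.mem_insert_iff] at hb hc
        by_cases h1 : b.1 = u
        · have h2 : c.1 ≠ u := fun h => hadj.ne (h1.trans h.symm)
          have h3 : c.1 = v := hl _ (by tauto) (by rwa [h1] at hadj)
          have : f b = f c := by
            simp only [f, h1, h2, dif_pos, dif_neg, not_false_eq_true]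
            exact Subtype.ext h3.symm
          rw [this]
        · by_cases h2 : c.1 = u
          · have h3 : b.1 = v := hl _ (by tauto) (by rw [h2] at hadj; exact hadj.symm)
            have : f b = f c := by
              simp only [f, h1, h2, dif_pos, dif_neg, not_false_eq_true]
              exact Subtype.ext h3
            rw [this]
          · apply SimpleGraph.Adj.reachable
            simp only [f, h1, h2, dif_neg, not_false_eq_true]
            exact hadj
    have hx : x.1 ≠ u := fun h => hu (h ▸ x.2)
    have hy : y.1 ≠ u := fun h => hu (h ▸ y.2)
    have := key ⟨x.1, by simp⟩ ⟨y.1, by simp⟩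
      (h.preconnected _ _)
    simpa only [f, hx, hy, dif_neg, not_false_eq_true] using this
  · intro h
    have : Nonempty (↑(insert u S) : Set V) := ⟨⟨u, by simp⟩⟩
    have hsub : (↑S : Set V) ⊆ ↑(insert u S) := by simp
    have key : ∀ x : (↑(insert u S) : Set V),
        (G.induce (↑(insert u S) : Set V)).Reachable x ⟨v, hsub hv⟩ := by
      intro x
      by_cases hx : x.1 = u
      · apply SimpleGraph.Adj.reachable
        show G.Adj x.1 v
        rw [hx]; exact huv
      · have hxS : x.1 ∈ S := by
          have := x.2
          simp only [Finset.coe_insert, Set.mem_insert_iff] at this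
          tauto
        exact (h.preconnected ⟨x.1, hxS⟩ ⟨v, hv⟩).map (G.induceHomOfLE hsub).toHom
    exact ⟨fun x y => (key x).trans (key y).symm⟩

/-- Vectors supported on `W` killed by the rows of the adjacency matrix indexed by `W`. -/
def locKer (G : SimpleGraph V) (W : Finset V) : Submodule ℚ (V → ℚ) where
  carrier := {x | (∀ v, v ∉ W → x v = 0) ∧ ∀ w ∈ W, ((G.adjMatrix ℚ).mulVec x) w = 0}
  add_mem' := by
    rintro a b ⟨h1, h2⟩ ⟨h3, h4⟩
    refine ⟨fun v hv => by simp [h1 v hv, h3 v hv], fun w hw => ?_⟩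
    rw [Matrix.mulVec_add, Pi.add_apply, h2 w hw, h4 w hw, add_zero]
  zero_mem' := by
    refine ⟨fun v hv => rfl, fun w hw => ?_⟩
    rw [Matrix.mulVec_zero]; rfl
  smul_mem' := by
    rintro c a ⟨h1, h2⟩
    refine ⟨fun v hv => by simp [h1 v hv], fun w hw => ?_⟩
    rw [Matrix.mulVec_smul, Pi.smul_apply, h2 w hw, smul_zero]

lemma mem_locKer (G : SimpleGraph V) (W : Finset V) (x : V → ℚ) : x ∈ locKer G W ↔
    (∀ v, v ∉ W → x v = 0) ∧ ∀ w ∈ W, ((G.adjMatrix ℚ).mulVec x) w = 0 := Iff.rfl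

lemma finrank_locKer_leaf (G : SimpleGraph V) (W : Finset V) (u v : V) (hu : u ∉ W) (hv : v ∉ W)
    (huv : G.Adj u v) (hl : ∀ w ∈ W, ¬ G.Adj u w) :
    Module.finrank ℚ (locKer G (insert u (insert v W))) = Module.finrank ℚ (locKer G W) := by
  have hne : u ≠ v := huv.ne
  have hsing : ∀ w, (G.adjMatrix ℚ).mulVec (Pi.single u (1:ℚ)) w = if G.Adj w u then 1 else 0 := by
    intro w
    simp [Matrix.mulVec_single, SimpleGraph.adjMatrix_apply]
  have hrowu : ∀ x ∈ locKer G (insert u (insert v W)), x v = 0 := by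
    rintro x ⟨h1, h2⟩
    have := h2 u (by simp)
    rw [SimpleGraph.adjMatrix_mulVec_apply, Finset.sum_eq_single v] at this
    · exact this
    · intro b hb hbv
      rw [SimpleGraph.mem_neighborFinset] at hb
      apply h1
      simp only [Finset.mem_insert, not_or]
      exact ⟨hb.ne', hbv, fun h => hl b h hb⟩
    · intro h; simp [huv] at h
  refine LinearEquiv.finrank_eq
    { toFun := fun x => ⟨x.1 - x.1 u • Pi.single u 1, ?_, ?_⟩
      invFun := fun x => ⟨x.1 - ((G.adjMatrix ℚ).mulVec x.1 v) • Pi.single u 1, ?_, ?_⟩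
      map_add' := ?_
      map_smul' := ?_
      left_inv := ?_
      right_inv := ?_ }
  · intro w hw
    by_cases h : w = u
    · subst h; simp
    · by_cases h' : w = v
      · subst h'; simp [h, hrowu x.1 x.2]
      · simp [h, x.2.1 w (by simp [h, h', hw])]
  · intro w hw
    rw [Matrix.mulVec_sub, Matrix.mulVec_smul, Pi.sub_apply, Pi.smul_apply, hsing,
      if_neg (fun h => hl w hw h.symm), x.2.2 w (by simp [hw])]
    simp
  · intro x y
    apply Subtype.ext
    simp only [Submodule.coe_add, Pi.add_apply, add_smul]
    abel
  · intro c x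
    apply Subtype.ext
    simp only [Submodule.coe_smul, Pi.smul_apply, RingHom.id_apply, smul_sub, smul_assoc]
  · intro w hw
    simp only [Finset.mem_insert, not_or] at hw
    simp [hw.1, x.2.1 w hw.2.2]
  · intro w hw
    rw [Matrix.mulVec_sub, Matrix.mulVec_smul, Pi.sub_apply, Pi.smul_apply, hsing]
    simp only [Finset.mem_insert] at hw
    rcases hw with rfl | rfl | hw
    · rw [if_neg (G.loopless.irrefl _), SimpleGraph.adjMatrix_mulVec_apply, Finset.sum_eq_zero]
      · simp
      · intro b hb
        rw [SimpleGraph.mem_neighborFinset] at hb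
        exact x.2.1 b (fun h => hl b h hb)
    · rw [if_pos huv.symm]; simp
    · rw [if_neg (fun h => hl w hw h.symm), x.2.2 w hw]; simp
  · intro x
    apply Subtype.ext
    have h1 := x.2.2 v (by simp)
    dsimp only
    rw [Matrix.mulVec_sub, Matrix.mulVec_smul, Pi.sub_apply, Pi.smul_apply, hsing,
      if_pos huv.symm, h1]
    simp
  · intro x
    apply Subtype.ext
    have h1 := x.2.1 u hu
    dsimp only
    simp [h1]

lemma finrank_locKer_indep (G : SimpleGraph V) (W : Finset V)
    (hl : ∀ v ∈ W, ∀ w ∈ W, ¬ G.Adj v w) :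
    Module.finrank ℚ (locKer G W) = W.card := by
  have : Module.finrank ℚ (W → ℚ) = W.card := by simp
  rw [← this]
  refine LinearEquiv.finrank_eq
    { toFun := fun x i => x.1 i.1
      invFun := fun y => ⟨fun v => if h : v ∈ W then y ⟨v, h⟩ else 0, ?_, ?_⟩
      map_add' := fun x y => rfl
      map_smul' := fun c x => rfl
      left_inv := ?_
      right_inv := ?_ }
  · intro v hv
    simp [hv]
  · intro w hw
    rw [SimpleGraph.adjMatrix_mulVec_apply, Finset.sum_eq_zero]
    intro b hb
    rw [SimpleGraph.mem_neighborFinset] at hb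
    rw [dif_neg (fun h => hl w hw b h hb)]
  · intro x
    apply Subtype.ext
    funext v
    by_cases h : v ∈ W
    · simp [h]
    · simp [h, x.2.1 v h]
  · intro y
    funext i
    simp

lemma kerDim_eq_locKer (G : SimpleGraph V) :
    kerDim G = Module.finrank ℚ (locKer G Finset.univ) := by
  unfold kerDim
  have : LinearMap.ker (Matrix.toLin' (G.adjMatrix ℚ)) = locKer G Finset.univ := by
    ext x
    rw [mem_locKer, LinearMap.mem_ker, Matrix.toLin'_apply, funext_iff]
    simp
  rw [← this]

lemma connected_isolated (G : SimpleGraph V) (S : Finset V) (u : V) (hu : u ∉ S)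
    (hl : ∀ w ∈ S, ¬ G.Adj u w) :
    (G.induce (↑(insert u S) : Set V)).Connected ↔ S = ∅ := by
  constructor
  · intro h
    by_contra hne
    obtain ⟨w, hw⟩ := Finset.nonempty_iff_ne_empty.mpr hne
    have := h.preconnected ⟨u, by simp⟩ ⟨w, by simp [hw]⟩
    rw [SimpleGraph.reachable_iff_reflTransGen] at this
    rcases Relation.ReflTransGen.cases_head this with h | ⟨c, hc, _⟩
    · simp only [Subtype.mk.injEq] at h
      exact hu (h ▸ hw)
    · have hadj : G.Adj u c.1 := hc
      have h2 := c.2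
      simp only [Finset.coe_insert, Set.mem_insert_iff] at h2
      rcases h2 with h2 | h2
      · exact hadj.ne h2.symm
      · exact hl _ h2 hadj
  · rintro rfl
    have : Nonempty (↑(insert u (∅ : Finset V)) : Set V) := ⟨⟨u, by simp⟩⟩
    refine ⟨fun x y => ?_⟩
    have : x = y := by
      have h1 := x.2
      have h2 := y.2
      simp at h1 h2
      exact Subtype.ext (h1.trans h2.symm)
    rw [this]

/-- signed indicator of connectedness -/
noncomputable def sgnConn (G : SimpleGraph V) (S : Finset V) : ℚ :=
  if (G.induce (↑S : Set V)).Connected then (-1 : ℚ) ^ (S.card + 1) else 0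

lemma not_connected_empty (G : SimpleGraph V) :
    ¬ (G.induce (↑(∅ : Finset V) : Set V)).Connected := by
  intro h
  obtain ⟨x, hx⟩ := h.nonempty
  simp at hx

lemma sum_sgnConn_indep (G : SimpleGraph V) (W : Finset V)
    (hl : ∀ v ∈ W, ∀ w ∈ W, ¬ G.Adj v w) :
    ∑ S ∈ W.powerset, sgnConn G S = W.card := by
  induction W using Finset.induction_on with
  | empty =>
    rw [Finset.powerset_empty, Finset.sum_singleton]
    unfold sgnConn
    rw [if_neg (not_connected_empty G)]
    simp
  | insert a s ha ih =>
    rw [Finset.sum_powerset_insert ha, ih (fun v hv w hw => hl v (by simp [hv]) w (by simp [hw])),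
      Finset.sum_eq_single ∅, Finset.card_insert_of_notMem ha]
    · have := (connected_isolated G ∅ a (by simp) (by simp)).mpr rfl
      unfold sgnConn
      rw [if_pos this]
      simp
    · intro t ht htne
      rw [Finset.mem_powerset] at ht
      unfold sgnConn
      rw [if_neg]
      rw [connected_isolated G t a (fun h => ha (ht h))
        (fun w hw => hl a (by simp) w (by simp [ht hw]))]
      exact htne
    · simp

lemma sum_sgnConn_leaf (G : SimpleGraph V) (W : Finset V) (u v : V) (hu : u ∉ W) (hv : v ∉ W)
    (huv : G.Adj u v) (hl : ∀ w ∈ W, ¬ G.Adj u w) :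
    ∑ S ∈ (insert u (insert v W)).powerset, sgnConn G S = 1 + ∑ S ∈ W.powerset, sgnConn G S := by
  have hne : u ≠ v := huv.ne
  rw [Finset.sum_powerset_insert (by simp [hne, hu]), Finset.sum_powerset_insert hv,
    Finset.sum_powerset_insert hv]
  have h1 : ∑ t ∈ W.powerset, sgnConn G (insert u t) = 1 := by
    rw [Finset.sum_eq_single ∅]
    · have := (connected_isolated G ∅ u (by simp) (by simp)).mpr rfl
      unfold sgnConn
      rw [if_pos this]
      simp
    · intro t ht htne
      rw [Finset.mem_powerset] at ht
      unfold sgnConn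
      rw [if_neg]
      rw [connected_isolated G t u (fun h => hu (ht h)) (fun w hw => hl w (ht hw))]
      exact htne
    · simp
  have h2 : ∑ t ∈ W.powerset, sgnConn G (insert u (insert v t)) =
      - ∑ t ∈ W.powerset, sgnConn G (insert v t) := by
    rw [← Finset.sum_neg_distrib]
    apply Finset.sum_congr rfl
    intro t ht
    rw [Finset.mem_powerset] at ht
    have hut : u ∉ insert v t := by
      simp only [Finset.mem_insert, not_or]
      exact ⟨hne, fun h => hu (ht h)⟩
    have := toggle_connected G (insert v t) u v hut (by simp) huv (by
      intro w hw hadj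
      rw [Finset.mem_insert] at hw
      rcases hw with h | h
      · exact h
      · exact absurd hadj (hl w (ht h)))
    unfold sgnConn
    simp only [this, Finset.card_insert_of_notMem hut]
    split_ifs
    · ring
    · simp
  rw [h1, h2]
  ring

/-- main pointwise identity, for graphs where each non-independent set has a relative leaf -/
lemma two_sum_sgnConn (G : SimpleGraph V)
    (hG : ∀ W : Finset V, (∃ a ∈ W, ∃ b ∈ W, G.Adj a b) →
      ∃ u ∈ W, ∃ v ∈ W, G.Adj u v ∧ ∀ w ∈ W, G.Adj u w → w = v) (W : Finset V) :
    2 * ∑ S ∈ W.powerset, sgnConn G S = W.card + Module.finrank ℚ (locKer G W) := by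
  induction W using Finset.strongInduction with
  | H W ih =>
  by_cases hW : ∃ a ∈ W, ∃ b ∈ W, G.Adj a b
  · obtain ⟨u, hu, v, hv, huv, hl⟩ := hG W hW
    have hne := huv.ne
    set W' := (W.erase u).erase v with hW'
    have hWW : W = insert u (insert v W') := by
      rw [hW', Finset.insert_erase (by simp [hv, hne.symm]), Finset.insert_erase hu]
    have hu' : u ∉ W' := by simp [hW']
    have hv' : v ∉ W' := by simp [hW']
    have hl' : ∀ w ∈ W', ¬ G.Adj u w := by
      intro w hw hadj
      have := hl w (by rw [hWW]; simp [hw]) hadj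
      exact hv' (this ▸ hw)
    have hss : W' ⊂ W := by
      refine Finset.ssubset_iff_subset_ne.mpr ⟨fun x hx => ?_, fun h => hu' (h ▸ hu)⟩
      rw [hWW]; simp [hx]
    have := ih W' hss
    rw [hWW, sum_sgnConn_leaf G W' u v hu' hv' huv hl', finrank_locKer_leaf G W' u v hu' hv' huv hl',
      Finset.card_insert_of_notMem (by simp [hne, hu']), Finset.card_insert_of_notMem hv', mul_add,
      this]
    push_cast
    ring
  · push Not at hW
    rw [sum_sgnConn_indep G W hW, finrank_locKer_indep G W hW]
    ring

end PartA

section PartB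
variable {V : Type*} [Fintype V] [DecidableEq V]

/-- parent functions rooted at `r` -/
def IsPar (r : V) (p : V → V) : Prop := p r = r ∧ ∀ v, ∃ k, p^[k] v = r

/-- the graph of a parent function -/
def pgraph (p : V → V) : SimpleGraph V := SimpleGraph.fromRel (fun v w => p v = w)

lemma pgraph_adj (p : V → V) (a b : V) :
    (pgraph p).Adj a b ↔ a ≠ b ∧ (p a = b ∨ p b = a) := by
  simp [pgraph, SimpleGraph.fromRel_adj]

lemma IsPar.depth {r : V} {p : V → V} (hp : IsPar r p) :
    ∃ d : V → ℕ, ∀ x, x ≠ r → d (p x) < d x := by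
  refine ⟨fun x => Nat.find (hp.2 x), fun x hx => ?_⟩
  have h := Nat.find_spec (hp.2 x)
  have h0 : Nat.find (hp.2 x) ≠ 0 := by
    intro h0
    rw [h0] at h
    exact hx h
  obtain ⟨k, hk⟩ := Nat.exists_eq_succ_of_ne_zero h0
  rw [hk] at h
  have := Nat.find_min' (hp.2 (p x)) h
  show Nat.find (hp.2 (p x)) < Nat.find (hp.2 x)
  omega

lemma IsPar.fix {r : V} {p : V → V} (hp : IsPar r p) {x : V} (hx : p x = x) : x = r := by
  obtain ⟨d, hd⟩ := hp.depth
  by_contra h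
  have := hd x h
  rw [hx] at this
  omega

lemma IsPar.two {r : V} {p : V → V} (hp : IsPar r p) {x : V} (hx : p (p x) = x) : x = r := by
  obtain ⟨d, hd⟩ := hp.depth
  by_contra h
  have h1 := hd x h
  by_cases h2 : p x = r
  · rw [h2, hp.1] at hx
    exact h hx.symm
  · have h3 := hd _ h2
    rw [hx] at h3
    omega

lemma IsPar.leaf {r : V} {p : V → V} (hp : IsPar r p) (W : Finset V)
    (hW : ∃ a ∈ W, ∃ b ∈ W, (pgraph p).Adj a b) :
    ∃ u ∈ W, ∃ v ∈ W, (pgraph p).Adj u v ∧ ∀ w ∈ W, (pgraph p).Adj u w → w = v := by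
  obtain ⟨d, hd⟩ := hp.depth
  have hne : (W.filter (fun x => p x ∈ W ∧ p x ≠ x)).Nonempty := by
    obtain ⟨a, ha, b, hb, hab⟩ := hW
    rw [pgraph_adj] at hab
    rcases hab with ⟨h1, h2 | h2⟩
    · exact ⟨a, by simp [ha, h2, hb, h1.symm]⟩
    · exact ⟨b, by simp [ha, h2, hb, h1]⟩
  obtain ⟨u, hu, hmax⟩ := Finset.exists_max_image _ d hne
  simp only [Finset.mem_filter] at hu hmax
  refine ⟨u, hu.1, p u, hu.2.1, ?_, ?_⟩
  · rw [pgraph_adj]; exact ⟨hu.2.2.symm, Or.inl rfl⟩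
  · intro w hw hadj
    rw [pgraph_adj] at hadj
    rcases hadj with ⟨h1, h2 | h2⟩
    · exact h2.symm
    · exfalso
      have h3 := hmax w ⟨hw, by rw [h2]; exact hu.1, by rw [h2]; exact h1⟩
      have h4 : w ≠ r := by
        rintro rfl
        exact h1 (h2.symm.trans hp.1)
      have h5 := hd w h4
      rw [h2] at h5
      omega

lemma IsPar.induce_connected_iff {r : V} {p : V → V} (hp : IsPar r p) (S : Finset V) (hr : r ∈ S) :
    ((pgraph p).induce (↑S : Set V)).Connected ↔ ∀ s ∈ S, p s ∈ S := by
  constructor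
  · intro h s hs
    by_contra hps
    have key : ∀ x : (↑S : Set V), ((pgraph p).induce (↑S : Set V)).Reachable ⟨s, hs⟩ x →
        ∃ k, p^[k] x.1 = s := by
      intro x hx
      rw [SimpleGraph.reachable_iff_reflTransGen] at hx
      induction hx with
      | refl => exact ⟨0, rfl⟩
      | @tail b c _ hbc ih =>
        obtain ⟨k, hk⟩ := ih
        have hadj : (pgraph p).Adj b.1 c.1 := hbc
        rw [pgraph_adj] at hadj
        rcases hadj with ⟨_, h2 | h2⟩
        · cases k with
          | zero =>
            exfalso
            simp only [Function.iterate_zero, id] at hk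
            rw [hk] at h2
            rw [h2] at hps
            exact hps c.2
          | succ k =>
            refine ⟨k, ?_⟩
            rw [Function.iterate_succ_apply, h2] at hk
            exact hk
        · refine ⟨k + 1, ?_⟩
          rw [Function.iterate_succ_apply, h2, hk]
    obtain ⟨k, hk⟩ := key ⟨r, hr⟩ (h.preconnected _ _)
    rw [Function.iterate_fixed hp.1] at hk
    subst hk
    rw [hp.1] at hps
    exact hps hr
  · intro h
    have : Nonempty (↑S : Set V) := ⟨⟨r, hr⟩⟩
    have key : ∀ k, ∀ x : (↑S : Set V), p^[k] x.1 = r →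
        ((pgraph p).induce (↑S : Set V)).Reachable x ⟨r, hr⟩ := by
      intro k
      induction k with
      | zero =>
        intro x hx
        have : x = ⟨r, hr⟩ := Subtype.ext hx
        rw [this]
      | succ k ih =>
        intro x hx
        rw [Function.iterate_succ_apply] at hx
        have h1 := ih ⟨p x.1, h _ x.2⟩ hx
        by_cases h2 : p x.1 = x.1
        · have : x = ⟨p x.1, h _ x.2⟩ := Subtype.ext h2.symm
          rw [this]; exact h1
        · refine SimpleGraph.Reachable.trans (SimpleGraph.Adj.reachable ?_) h1
          show (pgraph p).Adj x.1 (p x.1)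
          rw [pgraph_adj]
          exact ⟨fun h => h2 h.symm, Or.inl rfl⟩
    have key2 : ∀ x, ((pgraph p).induce (↑S : Set V)).Reachable x ⟨r, hr⟩ := fun x => by
      obtain ⟨k, hk⟩ := hp.2 x.1
      exact key k x hk
    exact ⟨fun x y => (key2 x).trans (key2 y).symm⟩

lemma IsPar.connected {r : V} {p : V → V} (hp : IsPar r p) : (pgraph p).Connected := by
  have := (hp.induce_connected_iff Finset.univ (by simp)).mpr (by simp)
  rw [Finset.coe_univ] at this
  exact (SimpleGraph.induceUnivIso _).connected_iff.mp this

lemma IsPar.isTree {r : V} {p : V → V} (hp : IsPar r p) : (pgraph p).IsTree := by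
  rw [SimpleGraph.isTree_iff_connected_and_card]
  refine ⟨hp.connected, ?_⟩
  have h1 := hp.connected.card_vert_le_card_edgeSet_add_one
  have h2 : Nat.card (pgraph p).edgeSet + 1 ≤ Nat.card V := by
    have h3 : (pgraph p).edgeSet ⊆ ↑((Finset.univ.erase r).image (fun v => s(v, p v))) := by
      intro e
      induction e using Sym2.ind with
      | h a b =>
        intro he
        rw [SimpleGraph.mem_edgeSet, pgraph_adj] at he
        simp only [Finset.coe_image, Set.mem_image, Finset.mem_coe, Finset.mem_erase,
          Finset.mem_univ, and_true]
        rcases he with ⟨h, h4 | h4⟩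
        · refine ⟨a, ?_, by rw [h4]⟩
          rintro rfl
          exact h (hp.1.symm.trans h4)
        · refine ⟨b, ?_, by rw [h4, Sym2.eq_swap]⟩
          rintro rfl
          exact h (h4.symm.trans hp.1)
    have h5 := Set.ncard_le_ncard h3 (Finset.finite_toSet _)
    rw [Set.ncard_coe_finset] at h5
    have h6 := h5.trans Finset.card_image_le
    rw [Finset.card_erase_of_mem (Finset.mem_univ r), Finset.card_univ] at h6
    rw [Nat.card_coe_set_eq, Nat.card_eq_fintype_card]
    have : 0 < Fintype.card V := Fintype.card_pos_iff.mpr ⟨r⟩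
    omega
  omega

lemma IsPar.inj {r : V} {p q : V → V} (hp : IsPar r p) (hq : IsPar r q)
    (h : pgraph p = pgraph q) : p = q := by
  have step : ∀ x, p x ≠ q x → p (p x) ≠ q (p x) := by
    intro x hx
    have hxr : x ≠ r := by
      rintro rfl
      exact hx (hp.1.trans hq.1.symm)
    have hadj : (pgraph p).Adj x (p x) := by
      rw [pgraph_adj]
      exact ⟨fun h => hxr (hp.fix h.symm), Or.inl rfl⟩
    rw [h, pgraph_adj] at hadj
    rcases hadj with ⟨_, h2 | h2⟩
    · exact absurd h2.symm hx
    · rw [h2]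
      exact fun h3 => hxr (hp.two h3)
  have key : ∀ k, ∀ x, p^[k] x = r → p x = q x := by
    intro k
    induction k with
    | zero =>
      intro x hx
      have : x = r := hx
      rw [this, hp.1, hq.1]
    | succ k ih =>
      intro x hx
      by_contra hne
      exact step x hne (ih (p x) hx)
  funext x
  obtain ⟨k, hk⟩ := hp.2 x
  exact key k x hk

lemma exists_par (T : SimpleGraph V) (hT : T.IsTree) (r : V) : ∃ p, IsPar r p ∧ pgraph p = T := by
  have h1 : ∀ v, v ≠ r → ∃ w, T.Adj v w ∧ T.dist w r < T.dist v r := by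
    intro v hv
    obtain ⟨w, hw⟩ := hT.connected.exists_walk_length_eq_dist v r
    cases w with
    | nil => exact absurd rfl hv
    | @cons _ b _ hadj w' =>
      refine ⟨b, hadj, ?_⟩
      have := SimpleGraph.dist_le w'
      rw [SimpleGraph.Walk.length_cons] at hw
      omega
  choose! f hf using h1
  let p : V → V := fun v => if v = r then r else f v
  have hp : IsPar r p := by
    refine ⟨by simp [p], ?_⟩
    have key : ∀ n, ∀ v, T.dist v r ≤ n → ∃ k, p^[k] v = r := by
      intro n
      induction n with
      | zero =>
        intro v hv
        refine ⟨0, ?_⟩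
        by_contra hne
        have := (hf v hne).2
        omega
      | succ n ih =>
        intro v hv
        by_cases hne : v = r
        · exact ⟨0, hne⟩
        · have h2 := (hf v hne).2
          obtain ⟨k, hk⟩ := ih (f v) (by omega)
          refine ⟨k + 1, ?_⟩
          rw [Function.iterate_succ_apply]
          simpa [p, hne] using hk
    exact fun v => key _ v le_rfl
  refine ⟨p, hp, ?_⟩
  have hle : pgraph p ≤ T := by
    intro a b hab
    rw [pgraph_adj] at hab
    have h3 : ∀ a b, a ≠ b → p a = b → T.Adj a b := by
      intro a b hne h
      by_cases har : a = r
      · exfalso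
        apply hne
        rw [← h, har, hp.1]
      · have := (hf a har).1
        simp only [p, har, if_false] at h
        rwa [h] at this
    rcases hab with ⟨h, h2 | h2⟩
    · exact h3 a b h h2
    · exact (h3 b a h.symm h2).symm
  have hmin := SimpleGraph.isTree_iff_minimal_connected.mp hT
  exact le_antisymm hle (hmin.2 hp.connected hle)

end PartB

section PartC
variable {V : Type*} [Fintype V] [DecidableEq V]

/-- functions fixing `R`, eventually reaching `R`, and preserving `S` -/
noncomputable def cnt (S R : Finset V) : Finset (V → V) :=
  Finset.univ.filter (fun p => (∀ x ∈ R, p x = x) ∧ (∀ v, ∃ k, p^[k] v ∈ R) ∧ ∀ s ∈ S, p s ∈ S)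

lemma mem_cnt (S R : Finset V) (p : V → V) : p ∈ cnt S R ↔
    (∀ x ∈ R, p x = x) ∧ (∀ v, ∃ k, p^[k] v ∈ R) ∧ ∀ s ∈ S, p s ∈ S := by
  simp [cnt]

/-- pairs (forest, vertex of `S` in the tree of `s`) -/
noncomputable def qs (S R : Finset V) (s : V) : Finset ((V → V) × V) :=
  (cnt S R ×ˢ S).filter (fun Fw => ∃ k, Fw.1^[k] Fw.2 = s)

lemma mem_qs (S R : Finset V) (s : V) (F : V → V) (w : V) : (F, w) ∈ qs S R s ↔
    (F ∈ cnt S R ∧ w ∈ S) ∧ ∃ k, F^[k] w = s := by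
  simp [qs]

lemma iterate_reach_unique (F : V → V) {w s t : V} (hs : F s = s) (ht : F t = t) {k l : ℕ}
    (h1 : F^[k] w = s) (h2 : F^[l] w = t) : s = t := by
  have h3 : F^[l + k] w = s := by
    rw [Function.iterate_add_apply, h1, Function.iterate_fixed hs]
  have h4 : F^[k + l] w = t := by
    rw [Function.iterate_add_apply, h2, Function.iterate_fixed ht]
  rw [add_comm] at h4
  exact h3.symm.trans h4

lemma sum_qs (S R : Finset V) :
    ∑ s ∈ R, (qs S R s).card = (cnt S R).card * S.card := by
  rw [← Finset.card_product, ← Finset.card_biUnion]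
  · congr 1
    ext ⟨F, w⟩
    simp only [Finset.mem_biUnion, mem_qs, Finset.mem_product]
    constructor
    · rintro ⟨s, _, h, _⟩
      exact h
    · intro h
      obtain ⟨k, hk⟩ := ((mem_cnt S R F).mp h.1).2.1 w
      exact ⟨_, hk, h, k, rfl⟩
  · intro s hs t ht hst
    show Disjoint (qs S R s) (qs S R t)
    rw [Finset.disjoint_left]
    rintro ⟨F, w⟩ h1 h2
    rw [mem_qs] at h1 h2
    obtain ⟨⟨hF, _⟩, k, hk⟩ := h1
    obtain ⟨_, l, hl⟩ := h2
    have hfix := ((mem_cnt S R F).mp hF).1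
    exact hst (iterate_reach_unique F (hfix s hs) (hfix t ht) hk hl)

lemma qs_card_le (S R : Finset V) (hRS : R ⊆ S) (s t : V) (hs : s ∈ R) (ht : t ∈ R) :
    (qs S R s).card ≤ (qs S R t).card := by
  set σ : V → V := fun x => Equiv.swap s t x with hσ
  have hσσ : ∀ x, σ (σ x) = x := fun x => Equiv.swap_apply_self s t x
  have hmem : ∀ A : Finset V, s ∈ A → t ∈ A → ∀ x ∈ A, σ x ∈ A := by
    intro A h1 h2 x hx
    simp only [hσ, Equiv.swap_apply_def]
    split_ifs <;> assumption
  apply Finset.card_le_card_of_injOn (fun Fw => (fun x => σ (Fw.1 (σ x)), σ Fw.2))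
  · rintro ⟨F, w⟩ h
    simp only [Finset.mem_coe] at h ⊢
    rw [mem_qs, mem_cnt] at h ⊢
    obtain ⟨⟨⟨h1, h2, h3⟩, h4⟩, k, hk⟩ := h
    have hsc : Function.Semiconj σ F (fun x => σ (F (σ x))) := fun x => by
      simp only [hσσ]
    have hit : ∀ k x, (fun x => σ (F (σ x)))^[k] (σ x) = σ (F^[k] x) := fun k x =>
      ((hsc.iterate_right k) x).symm
    refine ⟨⟨⟨?_, ?_, ?_⟩, hmem S (hRS hs) (hRS ht) w h4⟩, k, ?_⟩
    · intro x hx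
      show σ (F (σ x)) = x
      rw [h1 _ (hmem R hs ht x hx), hσσ]
    · intro v
      obtain ⟨l, hl⟩ := h2 (σ v)
      refine ⟨l, ?_⟩
      have := hit l (σ v)
      rw [hσσ] at this
      rw [this]
      exact hmem R hs ht _ hl
    · intro x hx
      exact hmem S (hRS hs) (hRS ht) _ (h3 _ (hmem S (hRS hs) (hRS ht) x hx))
    · show (fun x => σ (F (σ x)))^[k] (σ w) = t
      rw [hit, hk]
      simp [hσ]
  · rintro ⟨F, w⟩ _ ⟨F', w'⟩ _ h
    simp only [Prod.mk.injEq] at h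
    obtain ⟨h1, h2⟩ := h
    have hw : w = w' := by rw [← hσσ w, h2, hσσ]
    have hF : F = F' := by
      funext x
      have := congrFun h1 (σ x)
      simp only [hσσ] at this
      rw [← hσσ (F x), this, hσσ]
    rw [hw, hF]

lemma qs_card (S R : Finset V) (hRS : R ⊆ S) (v : V) (hv : v ∈ R) :
    R.card * (qs S R v).card = (cnt S R).card * S.card := by
  rw [← sum_qs, Finset.sum_congr rfl (fun s hs =>
    le_antisymm (qs_card_le S R hRS s v hs hv) (qs_card_le S R hRS v s hv hs)), Finset.sum_const,
    smul_eq_mul]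

lemma cnt_card_eq (S R : Finset V) (v : V) (hv : v ∈ S) (hvR : v ∉ R) :
    (cnt S R).card + (qs S (insert v R) v).card = (cnt S (insert v R)).card * S.card := by
  have hsub : qs S (insert v R) v ⊆ cnt S (insert v R) ×ˢ S := Finset.filter_subset _ _
  rw [← Finset.card_product, ← Finset.card_sdiff_add_card_eq_card hsub]
  congr 1
  have hmem : ∀ F w, (F, w) ∈ (cnt S (insert v R) ×ˢ S) \ qs S (insert v R) v ↔
      (F ∈ cnt S (insert v R) ∧ w ∈ S) ∧ ∀ k, F^[k] w ≠ v := by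
    intro F w
    rw [Finset.mem_sdiff, mem_qs, Finset.mem_product]
    simp only [not_and, not_exists]
    tauto
  refine Finset.card_bij' (fun p _ => (Function.update p v v, p v))
    (fun Fw _ => Function.update Fw.1 v Fw.2) ?_ ?_ ?_ ?_
  · intro p hp
    rw [mem_cnt] at hp
    obtain ⟨h1, h2, h3⟩ := hp
    rw [hmem, mem_cnt]
    set F := Function.update p v v with hF
    have hFv : F v = v := by simp [hF]
    have hFne : ∀ x, x ≠ v → F x = p x := fun x hx => by simp [hF, hx]
    refine ⟨⟨⟨?_, ?_, ?_⟩, h3 v hv⟩, ?_⟩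
    · intro x hx
      by_cases hxv : x = v
      · rw [hxv, hFv]
      · rw [hFne x hxv]
        exact h1 x (Finset.mem_of_mem_insert_of_ne hx hxv)
    · have key : ∀ k x, p^[k] x ∈ R → ∃ l, F^[l] x ∈ insert v R := by
        intro k
        induction k with
        | zero => exact fun x hx => ⟨0, Finset.mem_insert_of_mem hx⟩
        | succ k ih =>
          intro x hx
          by_cases hxv : x = v
          · exact ⟨0, by simp [hxv]⟩
          · obtain ⟨l, hl⟩ := ih (p x) hx
            refine ⟨l + 1, ?_⟩
            rw [Function.iterate_succ_apply, hFne x hxv]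
            exact hl
      intro x
      obtain ⟨k, hk⟩ := h2 x
      exact key k x hk
    · intro s hs
      by_cases hsv : s = v
      · rw [hsv, hFv]; exact hv
      · rw [hFne s hsv]; exact h3 s hs
    · intro k hk
      have key : ∀ k x, F^[k] x = v → ∃ j, p^[j] x = v := by
        intro k
        induction k with
        | zero => exact fun x hx => ⟨0, hx⟩
        | succ k ih =>
          intro x hx
          by_cases hxv : x = v
          · exact ⟨0, hxv⟩
          · rw [Function.iterate_succ_apply, hFne x hxv] at hx
            obtain ⟨l, hl⟩ := ih (p x) hx
            exact ⟨l + 1, hl⟩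
      obtain ⟨j, hj⟩ := key k _ hk
      have hj' : p^[j + 1] v = v := hj
      obtain ⟨i, hi⟩ := h2 v
      have h5 : p^[(j + 1) * i] v = v := by
        rw [Function.iterate_mul, Function.iterate_fixed hj']
      have h6 : p^[j * i + i] v = p^[i] v := by
        rw [Function.iterate_add_apply, Function.iterate_fixed (h1 _ hi)]
      rw [add_mul, one_mul, h6] at h5
      rw [h5] at hi
      exact hvR hi
  · rintro ⟨F, w⟩ hFw
    rw [hmem, mem_cnt] at hFw
    obtain ⟨⟨⟨h1, h2, h3⟩, hw⟩, h4⟩ := hFw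
    rw [mem_cnt]
    simp only
    set p := Function.update F v w with hp
    have hpv : p v = w := by simp [hp]
    have hpne : ∀ x, x ≠ v → p x = F x := fun x hx => by simp [hp, hx]
    have hit : ∀ k, p^[k] w = F^[k] w := by
      intro k
      induction k with
      | zero => rfl
      | succ k ih =>
        rw [Function.iterate_succ_apply', Function.iterate_succ_apply', ih, hpne _ (h4 k)]
    have hvreach : ∃ l, p^[l] v ∈ R := by
      obtain ⟨k, hk⟩ := h2 w
      refine ⟨k + 1, ?_⟩
      rw [Function.iterate_succ_apply, hpv, hit]
      exact Finset.mem_of_mem_insert_of_ne hk (h4 k)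
    refine ⟨?_, ?_, ?_⟩
    · intro x hx
      rw [hpne x (fun h => hvR (h ▸ hx))]
      exact h1 x (Finset.mem_insert_of_mem hx)
    · have key : ∀ k x, F^[k] x ∈ insert v R → ∃ l, p^[l] x ∈ R := by
        intro k
        induction k with
        | zero =>
          intro x hx
          by_cases hxv : x = v
          · rw [hxv]; exact hvreach
          · exact ⟨0, Finset.mem_of_mem_insert_of_ne hx hxv⟩
        | succ k ih =>
          intro x hx
          by_cases hxv : x = v
          · rw [hxv]; exact hvreach
          · obtain ⟨l, hl⟩ := ih (F x) hx
            refine ⟨l + 1, ?_⟩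
            rw [Function.iterate_succ_apply, hpne x hxv]
            exact hl
      intro x
      obtain ⟨k, hk⟩ := h2 x
      exact key k x hk
    · intro s hs
      by_cases hsv : s = v
      · rw [hsv, hpv]; exact hw
      · rw [hpne s hsv]; exact h3 s hs
  · intro p hp
    simp
  · rintro ⟨F, w⟩ hFw
    rw [hmem, mem_cnt] at hFw
    have := hFw.1.1.1 v (by simp)
    simp only [Function.update_idem, Function.update_self, Prod.mk.injEq, and_true]
    nth_rewrite 2 [← this]
    exact Function.update_eq_self v F

lemma cnt_card (S : Finset V) : ∀ d, ∀ R ⊆ S, S.card = R.card + d →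
    S.card * (cnt S R).card = R.card * S.card ^ d * (cnt S S).card := by
  intro d
  induction d with
  | zero =>
    intro R hR hd
    have : R = S := Finset.eq_of_subset_of_card_le hR (by omega)
    subst this
    simp
  | succ d ih =>
    intro R hR hd
    obtain ⟨v, hv, hvR⟩ : ∃ v ∈ S, v ∉ R := by
      by_contra h
      push Not at h
      have := Finset.card_le_card (show S ⊆ R from h)
      omega
    have hsub : insert v R ⊆ S := Finset.insert_subset hv hR
    have hc := Finset.card_insert_of_notMem hvR
    have h1 := ih (insert v R) hsub (by omega)
    have h2 := cnt_card_eq S R v hv hvR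
    have h3 := qs_card S (insert v R) hsub v (by simp)
    rw [hc] at h1 h3
    have h4 : (R.card + 1) * (cnt S R).card = R.card * ((cnt S (insert v R)).card * S.card) := by
      have : (R.card + 1) * (cnt S R).card + (cnt S (insert v R)).card * S.card
        = (R.card + 1) * ((cnt S (insert v R)).card * S.card) := by
        rw [← h3, ← mul_add, h2, ← h3]
      linarith
    have h5 : (R.card + 1) * (S.card * (cnt S R).card) =
        (R.card + 1) * (R.card * S.card ^ (d + 1) * (cnt S S).card) := by
      calc _ = S.card * ((R.card + 1) * (cnt S R).card) := by ring
        _ = R.card * S.card * (S.card * (cnt S (insert v R)).card) := by rw [h4]; ring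
        _ = _ := by rw [h1]; ring
    exact Nat.eq_of_mul_eq_mul_left (by omega) h5

lemma cnt_self (S : Finset V) : cnt S S = cnt Finset.univ S := by
  ext p
  rw [mem_cnt, mem_cnt]
  constructor
  · rintro ⟨h1, h2, h3⟩
    exact ⟨h1, h2, by simp⟩
  · rintro ⟨h1, h2, h3⟩
    exact ⟨h1, h2, fun s hs => by rw [h1 s hs]; exact hs⟩

lemma cnt_univ : (cnt (Finset.univ : Finset V) Finset.univ).card = 1 := by
  rw [Finset.card_eq_one]
  refine ⟨id, ?_⟩
  ext p
  rw [mem_cnt]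
  simp [funext_iff]

lemma cnt_final (S : Finset V) (r : V) (hr : r ∈ S) :
    ((cnt S {r}).card : ℚ) = (S.card : ℚ) ^ S.card * (Fintype.card V : ℚ) ^ (Fintype.card V - S.card)
      / ((Fintype.card V : ℚ) * S.card) := by
  have hpos : 0 < S.card := Finset.card_pos.mpr ⟨r, hr⟩
  have hle : S.card ≤ Fintype.card V := Finset.card_le_univ S
  obtain ⟨m, hm⟩ := Nat.exists_eq_succ_of_ne_zero hpos.ne'
  have h1 := cnt_card S m {r} (by simpa using hr) (by simp; omega)
  have h2 := cnt_card Finset.univ (Fintype.card V - S.card) S (Finset.subset_univ _)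
    (by rw [Finset.card_univ]; omega)
  rw [cnt_univ, ← cnt_self, Finset.card_univ] at h2
  rw [Finset.card_singleton, one_mul] at h1
  have hV : (Fintype.card V : ℚ) ≠ 0 := by
    have : Fintype.card V ≠ 0 := by omega
    exact_mod_cast this
  have hS : (S.card : ℚ) ≠ 0 := by exact_mod_cast hpos.ne'
  rw [eq_div_iff (mul_ne_zero hV hS)]
  have h1' : (S.card : ℚ) * (cnt S {r}).card = (S.card : ℚ) ^ m * (cnt S S).card := by
    exact_mod_cast h1
  have h2' : (Fintype.card V : ℚ) * (cnt S S).card =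
      S.card * (Fintype.card V : ℚ) ^ (Fintype.card V - S.card) * 1 := by
    exact_mod_cast h2
  have h3 : (S.card : ℚ) ^ S.card = (S.card : ℚ) ^ m * S.card := by
    conv_lhs => rw [hm]
    rw [pow_succ]
    simp [hm]
  rw [h3]
  calc _ = (Fintype.card V : ℚ) * ((S.card : ℚ) * (cnt S {r}).card) := by ring
    _ = (S.card : ℚ) ^ m * ((Fintype.card V : ℚ) * (cnt S S).card) := by rw [h1']; ring
    _ = _ := by rw [h2']; ring

end PartC

section PartD
variable {V : Type*} [Fintype V] [DecidableEq V]

lemma tree_count (S : Finset V) :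
    (((Finset.univ : Finset (SimpleGraph V)).filter
      (fun T => T.IsTree ∧ (T.induce (↑S : Set V)).Connected)).card : ℚ) =
    (S.card : ℚ) ^ S.card * (Fintype.card V : ℚ) ^ (Fintype.card V - S.card)
      / ((Fintype.card V : ℚ) * S.card) := by
  rcases S.eq_empty_or_nonempty with rfl | ⟨r, hr⟩
  · rw [Finset.filter_false_of_mem (fun T _ h => not_connected_empty T h.2)]
    simp
  · rw [← cnt_final S r hr]
    congr 1
    symm
    have hpar : ∀ p, p ∈ cnt S {r} ↔ IsPar r p ∧ ∀ s ∈ S, p s ∈ S := by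
      intro p
      rw [mem_cnt]
      simp [IsPar, and_assoc]
    refine Finset.card_bij (fun p _ => pgraph p) ?_ ?_ ?_
    · intro p hp
      rw [hpar] at hp
      rw [Finset.mem_filter]
      exact ⟨Finset.mem_univ _, hp.1.isTree, (hp.1.induce_connected_iff S hr).mpr hp.2⟩
    · intro p hp q hq h
      rw [hpar] at hp hq
      exact hp.1.inj hq.1 h
    · intro T hT
      rw [Finset.mem_filter] at hT
      obtain ⟨p, hp, rfl⟩ := exists_par T hT.2.1 r
      exact ⟨p, (hpar p).mpr ⟨hp, (hp.induce_connected_iff S hr).mp hT.2.2⟩, rfl⟩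

lemma tree_total (r : V) :
    (((Finset.univ : Finset (SimpleGraph V)).filter (fun T => T.IsTree)).card : ℚ) =
    (Fintype.card V : ℚ) ^ (Fintype.card V - 1) / (Fintype.card V : ℚ) := by
  have h := tree_count ({r} : Finset V)
  rw [Finset.card_singleton] at h
  simp only [Nat.cast_one, one_pow, one_mul, mul_one] at h
  rw [← h]
  congr 2
  ext T
  simp only [Finset.mem_filter, Finset.mem_univ, true_and]
  have := (connected_isolated T ∅ r (by simp) (by simp)).mpr rfl
  exact ⟨fun hT => ⟨hT, this⟩, fun hT => hT.1⟩

lemma kerDim_tree (T : SimpleGraph V) (hT : T.IsTree) :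
    (kerDim T : ℚ) = 2 * ∑ S : Finset V, sgnConn T S - Fintype.card V := by
  obtain ⟨r⟩ := hT.connected.nonempty
  obtain ⟨p, hp, rfl⟩ := exists_par T hT r
  have := two_sum_sgnConn (pgraph p) hp.leaf Finset.univ
  rw [Finset.powerset_univ, Finset.card_univ, ← kerDim_eq_locKer] at this
  rw [this]
  ring

lemma total_kerDim (r : V) :
    (∑ T : SimpleGraph V, if T.IsTree then (kerDim T : ℚ) else 0) =
      2 * ∑ m ∈ Finset.range (Fintype.card V + 1), (Fintype.card V).choose m • ((-1 : ℚ) ^ (m + 1) *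
        ((m : ℚ) ^ m * (Fintype.card V : ℚ) ^ (Fintype.card V - m)
          / ((Fintype.card V : ℚ) * m))) - (Fintype.card V : ℚ) ^ (Fintype.card V - 1) := by
  have hV : (Fintype.card V : ℚ) ≠ 0 := by
    have : Fintype.card V ≠ 0 := (Fintype.card_pos_iff.mpr ⟨r⟩).ne'
    exact_mod_cast this
  rw [← Finset.sum_filter, Finset.sum_congr rfl
    (fun T hT => kerDim_tree T (Finset.mem_filter.mp hT).2), Finset.sum_sub_distrib,
    ← Finset.mul_sum, Finset.sum_comm, Finset.sum_const, nsmul_eq_mul, tree_total r,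
    div_mul_cancel₀ _ hV]
  congr 2
  rw [← Finset.card_univ, ← Finset.sum_powerset_apply_card (fun m => (-1 : ℚ) ^ (m + 1) *
        ((m : ℚ) ^ m * ((Finset.univ : Finset V).card : ℚ) ^ ((Finset.univ : Finset V).card - m)
          / (((Finset.univ : Finset V).card : ℚ) * m))) (x := Finset.univ), Finset.powerset_univ]
  apply Finset.sum_congr rfl
  intro S _
  rw [Finset.card_univ, ← tree_count S]
  unfold sgnConn
  rw [← Finset.sum_filter, Finset.filter_filter, Finset.sum_const, nsmul_eq_mul, mul_comm]

end PartD

/-- The expectation `E(Z_n) = z_n / n^(n-2)`, where `z_n` is the sum over all labeled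
trees on `n` vertices of the kernel dimension of the adjacency matrix, equals
`n (1 - 2 ∑_{m=2}^{n} ((-1)^m / m) (m/n)^m choose n m)`. -/
theorem expectation_kernel_multiplicity (n : ℕ) (hn : 1 ≤ n) :
    (∑ G : SimpleGraph (Fin n), if G.IsTree then (kerDim G : ℚ) else 0) / (n : ℚ) ^ (n - 2) =
      n * (1 - 2 * ∑ m ∈ Finset.Icc 2 n,
        ((-1 : ℚ) ^ m / m) * ((m : ℚ) / n) ^ m * n.choose m) := by
  have htot := total_kerDim (V := Fin n) ⟨0, hn⟩
  rw [Fintype.card_fin] at htot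
  rw [htot]
  have hn0 : (n : ℚ) ≠ 0 := by
    have : n ≠ 0 := by omega
    exact_mod_cast this
  have hterm : ∀ m ∈ Finset.range (n + 1), n.choose m • ((-1 : ℚ) ^ (m + 1) *
        ((m : ℚ) ^ m * (n : ℚ) ^ (n - m) / ((n : ℚ) * m))) =
      - (n : ℚ) ^ n / n * (((-1 : ℚ) ^ m / m) * ((m : ℚ) / n) ^ m * n.choose m) := by
    intro m hm
    have hmn : m ≤ n := by
      rw [Finset.mem_range] at hm
      omega
    have h1 : (n : ℚ) ^ n = (n : ℚ) ^ (n - m) * (n : ℚ) ^ m := by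
      rw [← pow_add]
      congr 1
      omega
    rw [h1, nsmul_eq_mul, div_pow]
    have h2 : (n : ℚ) ^ m ≠ 0 := pow_ne_zero _ hn0
    rcases Nat.eq_zero_or_pos m with rfl | hm0
    · simp
    · have : (m : ℚ) ≠ 0 := by exact_mod_cast hm0.ne'
      field_simp
      ring
  rw [Finset.sum_congr rfl hterm, ← Finset.mul_sum]
  have hsplit : ∑ m ∈ Finset.range (n + 1), ((-1 : ℚ) ^ m / m) * ((m : ℚ) / n) ^ m * n.choose m =
      -1 + ∑ m ∈ Finset.Icc 2 n, ((-1 : ℚ) ^ m / m) * ((m : ℚ) / n) ^ m * n.choose m := by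
    rw [Finset.range_eq_Ico, Finset.sum_eq_sum_Ico_succ_bot (by omega),
      Finset.sum_eq_sum_Ico_succ_bot (by omega)]
    have : Finset.Ico (0 + 1 + 1) (n + 1) = Finset.Icc 2 n := by
      ext x
      simp only [Finset.mem_Ico, Finset.mem_Icc]
      omega
    rw [this]
    simp
    field_simp
  rw [hsplit]
  generalize ∑ m ∈ Finset.Icc 2 n, ((-1 : ℚ) ^ m / m) * ((m : ℚ) / n) ^ m * n.choose m = X
  obtain rfl | hn2 : n = 1 ∨ 2 ≤ n := by omega
  · norm_num
    ring
  · obtain ⟨k, rfl⟩ := Nat.exists_eq_add_of_le hn2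
    have e1 : 2 + k - 2 = k := by omega
    have e2 : 2 + k - 1 = k + 1 := by omega
    rw [e1, e2]
    generalize ((2 + k : ℕ) : ℚ) = N at *
    have : N ^ k ≠ 0 := pow_ne_zero _ hn0
    rw [div_eq_iff this, pow_add, pow_succ]
    field_simp
    ring
end

section
/- With z_n = n^{n-1} - 2·∑_{m=2}^{n} (-1)^m n^{n-m} m^{m-2} binom(n-1,m-1), the sequence E(Z_n)/n = z_n / n^{n-1} converges as n → ∞ to 2x_* - 1, where x_* is the unique real root of x = e^{-x}. -/
open Complex in
lemma swapSum {r : ℝ} (hr : 0 < r) (q g : ℂ → ℂ) (hq : ContinuousOn q (Metric.sphere 0 r))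
    (hg : ContinuousOn g (Metric.sphere 0 r)) :
    HasSum (fun j : ℕ => ∮ w in C(0, r), q w * ((g w) ^ j / (j.factorial : ℂ)))
      (∮ w in C(0, r), q w * exp (g w)) := by
  obtain ⟨B, hB⟩ := (isCompact_sphere (0:ℂ) r).exists_bound_of_continuousOn hq
  obtain ⟨G, hG⟩ := (isCompact_sphere (0:ℂ) r).exists_bound_of_continuousOn hg
  have hmem : ∀ θ : ℝ, circleMap 0 r θ ∈ Metric.sphere (0:ℂ) r := fun θ =>
    circleMap_mem_sphere 0 hr.le θ
  have hB0 : 0 ≤ B := (norm_nonneg _).trans (hB _ (hmem 0))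
  have hG0 : 0 ≤ G := (norm_nonneg _).trans (hG _ (hmem 0))
  have cq : Continuous (fun θ : ℝ => q (circleMap 0 r θ)) :=
    hq.comp_continuous (continuous_circleMap 0 r) hmem
  have cg : Continuous (fun θ : ℝ => g (circleMap 0 r θ)) :=
    hg.comp_continuous (continuous_circleMap 0 r) hmem
  simp only [circleIntegral, deriv_circleMap]
  refine intervalIntegral.hasSum_integral_of_dominated_convergence
    (fun j _ => r * (B * (G ^ j / (j.factorial : ℝ)))) ?_ ?_ ?_ ?_ ?_
  · intro j
    have := continuous_circleMap 0 r
    exact Continuous.aestronglyMeasurable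
      (Continuous.smul (this.mul continuous_const) (cq.mul ((cg.pow j).div_const _)))
  · intro j
    refine Filter.Eventually.of_forall fun θ _ => ?_
    simp only [smul_eq_mul, norm_mul, norm_div, norm_pow, norm_I, mul_one, Complex.norm_natCast]
    have h1 : ‖circleMap 0 r θ‖ = r := by simp [abs_of_pos hr]
    rw [h1]
    have := hB _ (hmem θ)
    have := hG _ (hmem θ)
    gcongr
  · refine Filter.Eventually.of_forall fun θ _ => ?_
    exact ((Real.summable_pow_div_factorial G).mul_left B).mul_left r
  · exact intervalIntegrable_const
  · refine Filter.Eventually.of_forall fun θ _ => ?_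
    refine HasSum.const_smul _ (HasSum.mul_left _ ?_)
    have := NormedSpace.expSeries_div_hasSum_exp (g (circleMap 0 r θ))
    rwa [← Complex.exp_eq_exp_ℂ] at this

open Complex in
lemma cauchyExp {r : ℝ} (hr : 0 < r) (c : ℂ) (p : ℕ) :
    (∮ w in C(0, r), exp (c * w) / w ^ (p + 1)) = 2 * Real.pi * I * (c ^ p / p.factorial) := by
  have h := DifferentiableOn.circleIntegral_one_div_sub_center_pow_smul (c := (0:ℂ))
    (f := fun w => exp (c * w)) hr p (by fun_prop)
  rw [iteratedDeriv_cexp_const_mul] at h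
  simp only [sub_zero, smul_eq_mul, mul_zero, exp_zero, mul_one] at h
  rw [← mul_div_assoc, mul_div_right_comm, ← h]
  congr 1; ext w; ring

open Complex in
lemma ci_entire {r : ℝ} (hr : 0 < r) (f : ℂ → ℂ) (hf : Differentiable ℂ f) :
    (∮ w in C(0, r), f w) = 0 :=
  circleIntegral_eq_zero_of_differentiable_on_off_countable hr.le Set.countable_empty
    hf.continuous.continuousOn (fun z _ => hf z)

open Complex in
lemma ci_div {r : ℝ} (hr : 0 < r) (f : ℂ → ℂ) (hf : Differentiable ℂ f) (p : ℕ) :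
    CircleIntegrable (fun w => f w / w ^ p) 0 r := by
  refine ContinuousOn.circleIntegrable hr.le (ContinuousOn.div hf.continuous.continuousOn
    (by fun_prop) ?_)
  intro w hw
  exact pow_ne_zero _ (ne_zero_of_mem_sphere hr.ne' ⟨w, hw⟩)

/-- coefficients -/
noncomputable def aco (x : ℂ) (k : ℕ) : ℂ :=
  if k = 0 then -x else (-1) ^ (k - 1) * (k : ℂ) ^ (k - 1) / k.factorial

open Complex in
lemma coeffInt {r : ℝ} (hr : 0 < r) (x : ℂ) (k : ℕ) :
    (∮ w in C(0, r), (1 + w) * (w - x) * exp (-(k : ℂ) * w) / w ^ (k + 1))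
      = 2 * Real.pi * I * aco x k := by
  have key : ∀ w ∈ Metric.sphere (0:ℂ) r, w ≠ 0 := fun w hw =>
    ne_zero_of_mem_sphere hr.ne' ⟨w, hw⟩
  rcases k with _ | _ | k
  · have : Set.EqOn (fun w : ℂ => (1 + w) * (w - x) * exp (-((0:ℕ) : ℂ) * w) / w ^ (0 + 1))
      (fun w => (w + (1 - x)) + (-x) * (exp (0 * w) / w ^ (0 + 1))) (Metric.sphere 0 r) := by
      intro w hw
      have := key w hw
      simp; field_simp; ring
    rw [circleIntegral.integral_congr hr.le this, circleIntegral.integral_add,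
      circleIntegral.integral_const_mul, cauchyExp hr, ci_entire hr]
    · simp [aco]; ring
    · fun_prop
    · exact Continuous.continuousOn (by fun_prop) |>.circleIntegrable hr.le
    · exact (ci_div hr (fun w => exp (0 * w)) (by fun_prop) 1).const_smul (a := -x)
  · have : Set.EqOn (fun w : ℂ => (1 + w) * (w - x) * exp (-((0 + 1 : ℕ) : ℂ) * w) / w ^ (0 + 1 + 1))
      (fun w => exp (-1 * w) + ((1 - x) * (exp (-1 * w) / w ^ (0 + 1))
        + (-x) * (exp (-1 * w) / w ^ (1 + 1)))) (Metric.sphere 0 r) := by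
      intro w hw
      have := key w hw
      simp; field_simp; ring
    have i0 : CircleIntegrable (fun w => (1 - x) * (exp (-1 * w) / w ^ (0 + 1))) 0 r := (ci_div hr (fun w => exp (-1 * w)) (by fun_prop) 1).const_smul (a := 1 - x)
    have i1 : CircleIntegrable (fun w => (-x) * (exp (-1 * w) / w ^ (1 + 1))) 0 r := (ci_div hr (fun w => exp (-1 * w)) (by fun_prop) 2).const_smul (a := - x)
    rw [circleIntegral.integral_congr hr.le this, circleIntegral.integral_add,
      circleIntegral.integral_add i0 i1,
      circleIntegral.integral_const_mul, circleIntegral.integral_const_mul,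
      cauchyExp hr, cauchyExp hr, ci_entire hr]
    · simp [aco]; ring
    · fun_prop
    · exact Continuous.continuousOn (by fun_prop) |>.circleIntegrable hr.le
    · exact i0.add i1
  · set c : ℂ := -((k + 1 + 1 : ℕ) : ℂ) with hc
    have : Set.EqOn (fun w : ℂ => (1 + w) * (w - x) * exp (c * w) / w ^ (k + 1 + 1 + 1))
      (fun w => exp (c * w) / w ^ (k + 1) + ((1 - x) * (exp (c * w) / w ^ (k + 1 + 1))
        + (-x) * (exp (c * w) / w ^ (k + 2 + 1)))) (Metric.sphere 0 r) := by
      intro w hw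
      have := key w hw
      simp; field_simp; ring
    have i := (ci_div hr (fun w => exp (c * w)) (by fun_prop) (k+1))
    have i0 : CircleIntegrable (fun w => (1 - x) * (exp (c * w) / w ^ (k + 1 + 1))) 0 r :=
      (ci_div hr (fun w => exp (c * w)) (by fun_prop) (k+1+1)).const_smul (a := 1 - x)
    have i1 : CircleIntegrable (fun w => (-x) * (exp (c * w) / w ^ (k + 2 + 1))) 0 r :=
      (ci_div hr (fun w => exp (c * w)) (by fun_prop) (k+2+1)).const_smul (a := - x)
    have i01 : CircleIntegrable (fun w => (1 - x) * (exp (c * w) / w ^ (k + 1 + 1))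
        + (-x) * (exp (c * w) / w ^ (k + 2 + 1))) 0 r := i0.add i1
    rw [circleIntegral.integral_congr hr.le this, circleIntegral.integral_add i i01,
      circleIntegral.integral_add i0 i1,
      circleIntegral.integral_const_mul, circleIntegral.integral_const_mul,
      cauchyExp hr, cauchyExp hr, cauchyExp hr]
    have e : ((-1 : ℂ)) ^ (k+1) * ((k + 1 + 1 : ℕ) : ℂ) ^ (k+1) = c ^ (k+1) := by
      rw [← mul_pow, hc]; ring
    have f1 : ((k.factorial : ℕ) : ℂ) ≠ 0 := by exact_mod_cast k.factorial_ne_zero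
    have f2 : ((k : ℂ) + 1) ≠ 0 := by exact_mod_cast k.succ_ne_zero
    have f3 : ((k : ℂ) + 1 + 1) ≠ 0 := by exact_mod_cast (k+1).succ_ne_zero
    have hck : (k : ℂ) = -c - 2 := by rw [hc]; push_cast; ring
    simp only [aco, Nat.add_eq_zero_iff, one_ne_zero, and_false, if_false, Nat.add_sub_cancel]
    rw [e]
    simp only [Nat.factorial_succ]
    push_cast
    field_simp
    rw [hck]
    ring

open Complex in
lemma mainInt {r : ℝ} (hr : 0 < r) (x : ℂ) (n : ℕ) :
    (∮ w in C(0, r), (1 + w) * (w - x) * exp (n * (w * exp w - w)) / w ^ (n + 1))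
      = 2 * Real.pi * I * ∑ k ∈ Finset.range (n + 1),
        (n : ℂ) ^ (n - k) / (n - k).factorial * aco x k := by
  have key : ∀ w ∈ Metric.sphere (0:ℂ) r, w ≠ 0 := fun w hw =>
    ne_zero_of_mem_sphere hr.ne' ⟨w, hw⟩
  have hs := swapSum hr (fun w => (1 + w) * (w - x) * exp (-n * w) / w ^ (n + 1))
    (fun w => n * (w * exp w))
    (ContinuousOn.div (by fun_prop) (by fun_prop) (fun w hw => pow_ne_zero _ (key w hw)))
    (by fun_prop)
  have e1 : (∮ w in C(0, r), (1 + w) * (w - x) * exp (n * (w * exp w - w)) / w ^ (n + 1))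
     = ∮ w in C(0, r), (1 + w) * (w - x) * exp (-n * w) / w ^ (n + 1) * exp (n * (w * exp w)) := by
    congr 1; ext w
    rw [show (n:ℂ) * (w * exp w - w) = -n * w + n * (w * exp w) by ring, exp_add]; ring
  rw [e1, ← hs.tsum_eq, tsum_eq_sum (s := Finset.range (n + 1)), Finset.mul_sum,
    ← Finset.sum_range_reflect]
  · refine Finset.sum_congr rfl fun k hk => ?_
    have hk' : k ≤ n := by simpa [Nat.lt_succ_iff] using hk
    obtain ⟨j, rfl⟩ := Nat.exists_eq_add_of_le hk'
    have : Set.EqOn (fun w : ℂ => (1 + w) * (w - x) * exp (-((k + j : ℕ) : ℂ) * w) / w ^ (k + j + 1) *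
          ((((k + j : ℕ) : ℂ) * (w * exp w)) ^ j / (j.factorial : ℂ)))
      (fun w => ((k + j : ℕ) : ℂ) ^ j / (j.factorial : ℂ) *
        ((1 + w) * (w - x) * exp (-(k : ℂ) * w) / w ^ (k + 1))) (Metric.sphere 0 r) := by
      intro w hw
      have := key w hw
      have f1 : ((j.factorial : ℕ) : ℂ) ≠ 0 := by exact_mod_cast j.factorial_ne_zero
      simp only []
      have : exp (-(k : ℂ) * w) = exp (-((k + j : ℕ) : ℂ) * w) * exp w ^ j := by
        rw [← exp_nat_mul, ← exp_add]; congr 1; push_cast; ring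
      rw [this]
      field_simp
      ring
    rw [show k + j + 1 - 1 - k = j by omega, show k + j - k = j by omega,
      circleIntegral.integral_congr hr.le this,
      circleIntegral.integral_const_mul, coeffInt hr]
    ring
  · intro j hj
    have hj' : n + 1 ≤ j := by simpa using hj
    obtain ⟨i, rfl⟩ := Nat.exists_eq_add_of_le hj'
    have : Set.EqOn (fun w : ℂ => (1 + w) * (w - x) * exp (-(n : ℂ) * w) / w ^ (n + 1) *
          (((n : ℂ) * (w * exp w)) ^ (n + 1 + i) / ((n + 1 + i).factorial : ℂ)))
      (fun w => (1 + w) * (w - x) * exp (-(n : ℂ) * w) *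
          ((n : ℂ) ^ (n + 1 + i) * w ^ i * exp w ^ (n + 1 + i)  / ((n + 1 + i).factorial : ℂ))) (Metric.sphere 0 r) := by
      intro w hw
      have := key w hw
      have f1 : (((n + 1 + i).factorial : ℕ) : ℂ) ≠ 0 := by exact_mod_cast (n + 1 + i).factorial_ne_zero
      simp only []
      field_simp
      ring
    rw [circleIntegral.integral_congr hr.le this, ci_entire hr]
    fun_prop

open Complex in
lemma reBound {x : ℝ} (hx : 0 < x) (hx1 : x < 1) (θ : ℝ) :
    (circleMap 0 x θ * exp (circleMap 0 x θ) - circleMap 0 x θ).re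
      ≤ x * Real.exp x - x - x ^ 3 / 8 * (1 - Real.cos θ) := by
  set w := circleMap 0 x θ with hw
  have hn : ‖w‖ = x := by simp [hw, abs_of_pos hx]
  have hpow : ∀ k : ℕ, (w ^ k).re = x ^ k * Real.cos (k * θ) := by
    intro k
    rw [hw, circleMap, zero_add, mul_pow, ← exp_nat_mul, ← ofReal_pow, re_ofReal_mul,
      show (k : ℂ) * (θ * I) = ((k * θ : ℝ) : ℂ) * I by push_cast; ring, exp_ofReal_mul_I_re]
  have h := Complex.norm_exp_sub_sum_le_exp_norm_sub_sum w 3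
  rw [hn] at h
  simp [Finset.sum_range_succ, Nat.factorial] at h
  have h2 : (w * (exp w - (1 + w + w ^ 2 / 2))).re ≤ x * (Real.exp x - (1 + x + x ^ 2 / 2)) := by
    refine (re_le_norm _).trans ?_
    rw [norm_mul, hn]
    gcongr
  have h3 : w * exp w - w = w ^ 2 + ((1 / 2 : ℝ) : ℂ) * w ^ 3 + w * (exp w - (1 + w + w ^ 2 / 2)) := by
    push_cast; ring
  rw [h3, add_re, add_re, re_ofReal_mul, hpow, hpow]
  push_cast
  rw [Real.cos_two_mul, Real.cos_three_mul]
  set C := Real.cos θ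
  have c1 : C ≤ 1 := Real.cos_le_one θ
  have c2 : -1 ≤ C := Real.neg_one_le_cos θ
  have h4 : x ^ 3 / 8 ≤ 2 * x ^ 2 * (1 + C) + x ^ 3 / 2 * (1 + 2 * C) ^ 2 := by
    have hx3 : 0 < x ^ 3 := by positivity
    have hx2 : x ^ 3 ≤ x ^ 2 := by nlinarith [sq_nonneg x]
    by_cases hC : -(3/4) ≤ C
    · nlinarith [sq_nonneg (1 + 2 * C), mul_nonneg hx3.le (sq_nonneg (1 + 2 * C))]
    · have : 1 / 4 ≤ (1 + 2 * C) ^ 2 := by nlinarith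
      nlinarith [mul_nonneg (sq_nonneg x) (by linarith : 0 ≤ 1 + C)]
  nlinarith [mul_le_mul_of_nonneg_right h4 (by linarith : 0 ≤ 1 - C)]

open Complex in
lemma normDiff {x : ℝ} (hx : 0 < x) (θ : ℝ) :
    ‖circleMap 0 x θ - x‖ = x * √(2 * (1 - Real.cos θ)) := by
  have : circleMap 0 x θ - x = x * (exp (θ * I) - 1) := by simp [circleMap]; ring
  rw [this, norm_mul, norm_real, Real.norm_of_nonneg hx.le]
  congr 1
  rw [Complex.norm_def, normSq_apply]
  congr 1
  simp [exp_ofReal_mul_I_re, exp_ofReal_mul_I_im]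
  nlinarith [Real.sin_sq_add_cos_sq θ]

/-- The rescaled integrand. -/
noncomputable def Fint (x : ℝ) (n : ℕ) (θ : ℝ) : ℂ :=
  (((√(2 * n) * Real.exp (-n) : ℝ)) : ℂ) * ((1 + circleMap 0 x θ) * (circleMap 0 x θ - x) *
    Complex.exp (n * (circleMap 0 x θ * Complex.exp (circleMap 0 x θ) - circleMap 0 x θ)) /
      circleMap 0 x θ ^ n)

lemma Fint_bound {x : ℝ} (hx : 0 < x) (hx1 : x < 1) (hxe : x * Real.exp x = 1) (n : ℕ) (θ : ℝ) :
    ‖Fint x n θ‖ ≤ 4 * (√(n * (1 - Real.cos θ)) *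
      Real.exp (-(x ^ 3 / 8) * (n * (1 - Real.cos θ)))) := by
  have hn : ‖circleMap 0 x θ‖ = x := by simp [abs_of_pos hx]
  have hu : 0 ≤ 1 - Real.cos θ := by linarith [Real.cos_le_one θ]
  have hb := reBound hx hx1 θ
  rw [hxe] at hb
  unfold Fint
  rw [norm_mul, norm_div, norm_mul, norm_mul, norm_pow, hn, normDiff hx, Complex.norm_exp,
    Complex.norm_real, Real.norm_of_nonneg (by positivity)]
  have h1 : ‖1 + circleMap 0 x θ‖ ≤ 2 := by
    refine (norm_add_le _ _).trans ?_
    rw [hn, norm_one]; linarith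
  have h2 : ((n : ℂ) * (circleMap 0 x θ * Complex.exp (circleMap 0 x θ) - circleMap 0 x θ)).re
      ≤ n * (1 - x - x ^ 3 / 8 * (1 - Real.cos θ)) := by
    rw [← Complex.ofReal_natCast, Complex.re_ofReal_mul]
    gcongr
  have hxn : x ^ n = Real.exp (-(n * x)) := by
    have : x = Real.exp (-x) := by
      rw [Real.exp_neg]; field_simp; linarith
    conv_lhs => rw [this]
    rw [← Real.exp_nat_mul]; congr 1; ring
  calc _ ≤ √(2 * n) * Real.exp (-n) * (2 * (1 * √(2 * (1 - Real.cos θ))) *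
        Real.exp (n * (1 - x - x ^ 3 / 8 * (1 - Real.cos θ))) / Real.exp (-(n * x))) := by
        rw [hxn]; gcongr
    _ = 2 * (√(2 * n) * √(2 * (1 - Real.cos θ))) * (Real.exp (-n) *
        (Real.exp (n * (1 - x - x ^ 3 / 8 * (1 - Real.cos θ))) / Real.exp (-(n * x)))) := by ring
    _ = _ := by
      rw [← Real.exp_sub, ← Real.exp_add, ← Real.sqrt_mul (by positivity),
        show (2 * (n:ℝ)) * (2 * (1 - Real.cos θ)) = 2 ^ 2 * (n * (1 - Real.cos θ)) by ring,
        Real.sqrt_mul (by positivity), Real.sqrt_sq (by norm_num)]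
      rw [show -(n:ℝ) + (n * (1 - x - x ^ 3 / 8 * (1 - Real.cos θ)) - -(n * x))
        = -(x ^ 3 / 8) * (n * (1 - Real.cos θ)) by ring]
      ring

lemma sqrtExp {c : ℝ} (hc : 0 < c) {t : ℝ} (ht : 0 ≤ t) :
    √t * Real.exp (-c * t) ≤ 1 / c + 1 := by
  have h1 : √t ≤ 1 + t := by
    rw [Real.sqrt_le_left (by linarith)]; nlinarith
  have h2 : Real.exp (-c * t) * (1 + c * t) ≤ 1 := by
    have := Real.add_one_le_exp (c * t)
    calc _ ≤ Real.exp (-c * t) * Real.exp (c * t) := by gcongr; linarith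
      _ = 1 := by rw [← Real.exp_add]; simp
  have h3 : 1 + t ≤ (1 / c + 1) * (1 + c * t) := by
    have : (1 / c + 1) * (1 + c * t) = 1 / c + t + 1 + c * t := by field_simp; ring
    rw [this]
    have : 0 < 1 / c := by positivity
    have : 0 ≤ c * t := by positivity
    linarith
  have h4 := Real.exp_pos (-c * t)
  have h5 : 0 < 1 / c + 1 := by positivity
  calc _ ≤ ((1 / c + 1) * (1 + c * t)) * Real.exp (-c * t) := by gcongr; linarith
    _ = (1 / c + 1) * (Real.exp (-c * t) * (1 + c * t)) := by ring
    _ ≤ (1 / c + 1) * 1 := by gcongr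
    _ = _ := by ring

lemma sqrtExp_tendsto {c : ℝ} (hc : 0 < c) :
    Filter.Tendsto (fun t : ℝ => √t * Real.exp (-c * t)) Filter.atTop (nhds 0) := by
  have := tendsto_rpow_mul_exp_neg_mul_atTop_nhds_zero (1/2) c hc
  simpa [Real.sqrt_eq_rpow] using this

lemma Fint_tendsto {x : ℝ} (hx : 0 < x) (hx1 : x < 1) (hxe : x * Real.exp x = 1) :
    Filter.Tendsto (fun n : ℕ => ∫ θ in (0:ℝ)..2 * Real.pi, Fint x n θ) Filter.atTop (nhds 0) := by
  have hc : 0 < x ^ 3 / 8 := by positivity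
  have hu : ∀ θ, 0 ≤ 1 - Real.cos θ := fun θ => by linarith [Real.cos_le_one θ]
  have h0 : (0:ℂ) = ∫ θ in (0:ℝ)..2 * Real.pi, (0:ℂ) := by simp
  rw [h0]
  refine intervalIntegral.tendsto_integral_filter_of_dominated_convergence
    (fun _ => 4 * (1 / (x ^ 3 / 8) + 1)) ?_ ?_ ?_ ?_
  · refine Filter.Eventually.of_forall fun n => ?_
    apply Continuous.aestronglyMeasurable
    unfold Fint
    have := continuous_circleMap 0 x
    refine continuous_const.mul (Continuous.div (by fun_prop) (by fun_prop) ?_)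
    intro θ
    exact pow_ne_zero _ (circleMap_ne_center hx.ne')
  · refine Filter.Eventually.of_forall fun n => Filter.Eventually.of_forall fun θ _ => ?_
    refine (Fint_bound hx hx1 hxe n θ).trans ?_
    have := sqrtExp hc (mul_nonneg (Nat.cast_nonneg n) (hu θ))
    gcongr
  · exact intervalIntegrable_const
  · refine Filter.Eventually.of_forall fun θ _ => ?_
    refine squeeze_zero_norm (fun n => Fint_bound hx hx1 hxe n θ) ?_
    rcases (hu θ).eq_or_lt with h | h
    · simp [← h]
    · have := (sqrtExp_tendsto hc).comp (tendsto_natCast_atTop_atTop.atTop_mul_const h)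
      simpa [Function.comp_def] using this.const_mul 4

lemma scaled_tendsto {x : ℝ} (hx : 0 < x) (hx1 : x < 1) (hxe : x * Real.exp x = 1) :
    Filter.Tendsto (fun n : ℕ => ((n.factorial : ℂ) / (n : ℂ) ^ n) *
      ∑ k ∈ Finset.range (n + 1), (n : ℂ) ^ (n - k) / (n - k).factorial * aco x k)
      Filter.atTop (nhds 0) := by
  have hpi : (Real.pi : ℂ) ≠ 0 := by exact_mod_cast Real.pi_ne_zero
  have h1 : ∀ n : ℕ, (∫ θ in (0:ℝ)..2 * Real.pi, Fint x n θ) =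
      (((√(2 * n) * Real.exp (-n) : ℝ)) : ℂ) * (2 * Real.pi *
      ∑ k ∈ Finset.range (n + 1), (n : ℂ) ^ (n - k) / (n - k).factorial * aco x k) := by
    intro n
    have h := mainInt hx x n
    simp only [circleIntegral, deriv_circleMap] at h
    unfold Fint
    rw [intervalIntegral.integral_const_mul]
    congr 1
    apply mul_left_cancel₀ Complex.I_ne_zero
    rw [← intervalIntegral.integral_const_mul, ← mul_assoc, mul_comm Complex.I, ← h]
    congr 1
    ext θ
    have : circleMap 0 x θ ≠ 0 := circleMap_ne_center hx.ne'
    simp only [smul_eq_mul]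
    field_simp
    ring
  have h2 : Filter.Tendsto (fun n : ℕ => ((Stirling.stirlingSeq n : ℝ) : ℂ)) Filter.atTop
      (nhds ((√Real.pi : ℝ) : ℂ)) :=
    (Complex.continuous_ofReal.tendsto _).comp Stirling.tendsto_stirlingSeq_sqrt_pi
  have h3 := (h2.mul (Fint_tendsto hx hx1 hxe)).mul_const ((2 * (Real.pi : ℂ))⁻¹)
  rw [mul_zero, zero_mul] at h3
  refine h3.congr' ?_
  filter_upwards [Filter.eventually_ge_atTop 1] with n hn
  rw [h1 n]
  have hn0 : (0:ℝ) < n := by exact_mod_cast hn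
  have h4 : Stirling.stirlingSeq n * (√(2 * n) * Real.exp (-n)) = n.factorial / (n:ℝ) ^ n := by
    unfold Stirling.stirlingSeq
    have : √(2 * (n:ℝ)) ≠ 0 := by positivity
    rw [div_pow, Real.exp_neg, ← Real.exp_nat_mul, mul_one]
    have := Real.exp_pos (n:ℝ)
    field_simp
  have h5 : ((Stirling.stirlingSeq n : ℝ) : ℂ) * (((√(2 * n) * Real.exp (-n) : ℝ)) : ℂ)
      = (n.factorial : ℂ) / (n : ℂ) ^ n := by
    rw [← Complex.ofReal_mul, h4]; push_cast; rfl
  rw [← h5]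
  field_simp

lemma sumIdentity (x : ℝ) (n : ℕ) (hn : 1 ≤ n) :
    ((n.factorial : ℂ) / (n : ℂ) ^ n) *
      ∑ k ∈ Finset.range (n + 1), (n : ℂ) ^ (n - k) / (n - k).factorial * aco x k
    = -x + 1 - (∑ m ∈ Finset.Icc 2 n,
        (-1 : ℂ) ^ m * (n : ℂ) ^ (n - m) * (m : ℂ) ^ (m - 2) * ((n - 1).choose (m - 1)))
        / (n : ℂ) ^ (n - 1) := by
  have hn0 : (n : ℂ) ≠ 0 := by exact_mod_cast (by omega : n ≠ 0)
  have hf : ∀ k : ℕ, ((k.factorial : ℕ) : ℂ) ≠ 0 := fun k => by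
    exact_mod_cast k.factorial_ne_zero
  have hset : Finset.range (n + 1) = insert 0 (insert 1 (Finset.Icc 2 n)) := by
    ext k; simp; omega
  rw [hset, Finset.sum_insert (by simp), Finset.sum_insert (by simp), mul_add, mul_add,
    ← add_assoc, sub_eq_add_neg]
  congr 1
  · obtain ⟨p, rfl⟩ := Nat.exists_eq_add_of_le' hn
    have := hf p
    have := hf (p + 1)
    simp only [aco, Nat.sub_zero, if_true, one_ne_zero, if_false, Nat.add_sub_cancel,
      Nat.factorial_succ, pow_succ]
    push_cast at *
    have : (p : ℂ) + 1 ≠ 0 := hn0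
    simp
    field_simp
  · rw [Finset.mul_sum, Finset.sum_div, ← Finset.sum_neg_distrib]
    refine Finset.sum_congr rfl fun m hm => ?_
    obtain ⟨hm2, hmn⟩ := Finset.mem_Icc.mp hm
    obtain ⟨q, rfl⟩ := Nat.exists_eq_add_of_le' hm2
    obtain ⟨s, rfl⟩ := Nat.exists_eq_add_of_le' hmn
    have e : ((s + (q + 2) - 1).choose (q + 2 - 1) : ℂ)
        = (s + q + 1).factorial / ((q + 1).factorial * s.factorial) := by
      rw [show s + (q + 2) - 1 = s + (q + 1) by omega, show q + 2 - 1 = q + 1 by omega,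
        Nat.add_choose, Nat.cast_div, Nat.cast_mul, mul_comm]
      · rfl
      · exact Nat.factorial_mul_factorial_dvd_factorial_add s (q + 1)
      · have := hf s
        have := hf (q + 1)
        push_cast; positivity
    rw [e, show s + (q + 2) - (q + 2) = s by omega, show s + (q + 2) - 1 = s + q + 1 by omega,
      show q + 2 - 2 = q by omega, show s + (q + 2) = (s + q + 1) + 1 by omega] at *
    rw [aco, if_neg (by omega), show q + 2 - 1 = q + 1 by omega,
      Nat.factorial_succ (s + q + 1), Nat.factorial_succ (q + 1)]
    have a1 := hf s
    have a2 := hf (q + 1)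
    have a3 : ((q + 1 + 1 : ℕ) : ℂ) ≠ 0 := by exact_mod_cast (q + 1).succ_ne_zero
    rw [Nat.cast_mul, Nat.cast_mul, show q + 2 = q + 1 + 1 from rfl]
    generalize ((s + q + 1 + 1 : ℕ) : ℂ) = N at *
    generalize ((q + 1 + 1 : ℕ) : ℂ) = M at *
    field_simp
    ring

/-- With `z n = n^(n-1) - 2 ∑_{m=2}^{n} (-1)^m n^(n-m) m^(m-2) choose (n-1) (m-1)`
(the total multiplicity of the eigenvalue 0 over all labeled trees on `n` vertices),
the sequence `z n / n^(n-1)` converges, as `n → ∞`, to `2 x₀ - 1` where `x₀` is the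
unique real root of `x = e^(-x)`. -/
theorem expectation_fraction_tendsto (x₀ : ℝ) (hx₀ : x₀ = Real.exp (-x₀))
    (z : ℕ → ℤ)
    (hz : ∀ n, 1 ≤ n → z n = (n : ℤ) ^ (n - 1) -
      2 * ∑ m ∈ Finset.Icc 2 n,
        (-1 : ℤ) ^ m * (n : ℤ) ^ (n - m) * (m : ℤ) ^ (m - 2) * ((n - 1).choose (m - 1))) :
    Filter.Tendsto (fun n : ℕ => (z n : ℝ) / (n : ℝ) ^ (n - 1))
      Filter.atTop (nhds (2 * x₀ - 1)) := by
  have hxpos : 0 < x₀ := by rw [hx₀]; exact Real.exp_pos _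
  have hx1 : x₀ < 1 := by
    rw [hx₀]; simpa using hxpos
  have hxe : x₀ * Real.exp x₀ = 1 := by
    nth_rewrite 1 [hx₀]
    rw [← Real.exp_add]; simp
  have h := (Complex.continuous_re.tendsto _).comp (scaled_tendsto hxpos hx1 hxe)
  have h' := (h.const_mul 2).add_const (2 * x₀ - 1)
  rw [Complex.zero_re, mul_zero, zero_add] at h'
  refine h'.congr' ?_
  filter_upwards [Filter.eventually_ge_atTop 1] with n hn
  have hn0 : (n : ℝ) ≠ 0 := by exact_mod_cast (by omega : n ≠ 0)
  simp only [Function.comp_apply]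
  rw [sumIdentity x₀ n hn]
  have e : ((-x₀ + 1 - (∑ m ∈ Finset.Icc 2 n,
        (-1 : ℂ) ^ m * (n : ℂ) ^ (n - m) * (m : ℂ) ^ (m - 2) * ((n - 1).choose (m - 1)))
        / (n : ℂ) ^ (n - 1)) : ℂ) = ((-x₀ + 1 - (∑ m ∈ Finset.Icc 2 n,
        (-1 : ℝ) ^ m * (n : ℝ) ^ (n - m) * (m : ℝ) ^ (m - 2) * ((n - 1).choose (m - 1)))
        / (n : ℝ) ^ (n - 1) : ℝ) : ℂ) := by
    push_cast; rfl
  rw [e, Complex.ofReal_re, hz n hn]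
  push_cast
  field_simp
  ring
end

section
/- For any finite forest F, L(F) = ∑_{F' induced subforest of F} (-1)^{N(F) - N(F')} Z(F'), where Z is the kernel dimension of the adjacency matrix and L is the function taking value 0 on the empty forest and on disconnected forests, 1 on the single vertex, and 2(-1)^{n-1} on trees with n ≥ 2 vertices. -/
open Classical

lemma exists_leaf_aux {W : Type*} [Finite W] [Nonempty W] (G : SimpleGraph W) (hG : G.IsAcyclic) :
    ∃ v, ∀ a b, G.Adj v a → G.Adj v b → a = b := by
  classical
  have := Fintype.ofFinite W
  obtain ⟨x⟩ := (inferInstance : Nonempty W)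
  set c := G.connectedComponentMk x with hc
  have ht := hG.isTree_connectedComponent c
  have key : ∃ v : c, ∀ a b : c, c.toSimpleGraph.Adj v a → c.toSimpleGraph.Adj v b → a = b := by
    rcases subsingleton_or_nontrivial c with h | h
    · exact ⟨⟨x, rfl⟩, fun a b _ _ => Subsingleton.elim _ _⟩
    · obtain ⟨v, hv⟩ := ht.exists_vert_degree_one_of_nontrivial
      obtain ⟨w, _, hw⟩ := SimpleGraph.degree_eq_one_iff_existsUnique_adj.mp hv
      exact ⟨v, fun a b ha hb => (hw a ha).trans (hw b hb).symm⟩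
  obtain ⟨⟨v, hv⟩, h⟩ := key
  have hmem : ∀ a, G.Adj v a → a ∈ c := fun a ha => by
    have h1 : G.connectedComponentMk v = c := hv
    have h2 : G.connectedComponentMk v = G.connectedComponentMk a :=
      SimpleGraph.ConnectedComponent.sound ha.reachable
    exact h2.symm.trans h1
  refine ⟨v, fun a b ha hb => ?_⟩
  exact congrArg Subtype.val (h ⟨a, hmem a ha⟩ ⟨b, hmem b hb⟩ ha hb)

lemma exists_leaf_finset {V : Type*} (F : SimpleGraph V) (hF : F.IsAcyclic) (s : Finset V)
    (hs : s.Nonempty) : ∃ v ∈ s, ∀ a ∈ s, ∀ b ∈ s, F.Adj v a → F.Adj v b → a = b := by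
  obtain ⟨x, hx⟩ := hs
  have : Nonempty (s : Set V) := ⟨⟨x, hx⟩⟩
  obtain ⟨⟨v, hv⟩, h⟩ := exists_leaf_aux (F.induce (s : Set V)) (hF.induce _)
  exact ⟨v, hv, fun a ha b hb h1 h2 => congrArg Subtype.val (h ⟨a, ha⟩ ⟨b, hb⟩ h1 h2)⟩

/-- kernel of the adjacency matrix of the induced subgraph, realised in the space of functions on V -/
noncomputable def kerSub {V : Type*} [Fintype V] (F : SimpleGraph V) (s : Finset V) :
    Submodule ℚ (V → ℚ) where
  carrier := {x | (∀ u, u ∉ s → x u = 0) ∧ ∀ u ∈ s, ∑ w, (if F.Adj u w then x w else 0) = 0}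
  zero_mem' := by simp
  add_mem' := by
    rintro x y ⟨hx, hx'⟩ ⟨hy, hy'⟩
    refine ⟨fun u hu => by simp [hx u hu, hy u hu], fun u hu => ?_⟩
    have : ∀ w, (if F.Adj u w then (x + y) w else 0) =
      (if F.Adj u w then x w else 0) + (if F.Adj u w then y w else 0) := by
      intro w; split_ifs <;> simp
    simp only [this, Finset.sum_add_distrib, hx' u hu, hy' u hu, add_zero]
  smul_mem' := by
    rintro c x ⟨hx, hx'⟩
    refine ⟨fun u hu => by simp [hx u hu], fun u hu => ?_⟩
    have : ∀ w, (if F.Adj u w then (c • x) w else 0) = c * (if F.Adj u w then x w else 0) := by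
      intro w; split_ifs <;> simp
    simp only [this, ← Finset.mul_sum, hx' u hu, mul_zero]

lemma mem_kerSub {V : Type*} [Fintype V] (F : SimpleGraph V) (s : Finset V) (x : V → ℚ) :
    x ∈ kerSub F s ↔
      (∀ u, u ∉ s → x u = 0) ∧ ∀ u ∈ s, ∑ w, (if F.Adj u w then x w else 0) = 0 := Iff.rfl

lemma sum_sub_aux {V : Type*} [Fintype V] (s : Finset V) [Fintype (s : Set V)] (f : V → ℚ)
    (hf : ∀ u, u ∉ s → f u = 0) : ∑ w : (s : Set V), f w = ∑ w, f w := by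
  rw [← Finset.sum_subset (Finset.subset_univ s) (fun u _ hu => hf u hu)]
  exact (Finset.sum_subtype s (fun x => by simp) f).symm

lemma kerDim_eq_s17 {V : Type*} [Fintype V] (F : SimpleGraph V) (s : Finset V)
    [Fintype (s : Set V)] [DecidableEq (s : Set V)] :
    kerDim (F.induce (s : Set V)) = Module.finrank ℚ (kerSub F s) := by
  unfold kerDim
  have hmem : ∀ y : ↥(s : Set V) → ℚ,
      y ∈ LinearMap.ker (Matrix.toLin' ((F.induce (s : Set V)).adjMatrix ℚ)) ↔
      ∀ u : (s : Set V), ∑ w : (s : Set V), (if F.Adj u w then y w else 0) = 0 := by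
    intro y
    rw [LinearMap.mem_ker, Matrix.toLin'_apply, funext_iff]
    simp [Matrix.mulVec, dotProduct, SimpleGraph.adjMatrix_apply, ite_mul]
  symm
  apply LinearEquiv.finrank_eq
  refine LinearEquiv.ofBijective
    (((LinearMap.funLeft ℚ ℚ (Subtype.val : ↥(s : Set V) → V)).domRestrict (kerSub F s)).codRestrict
      _ ?_) ⟨?_, ?_⟩
  · rintro ⟨x, hx⟩
    refine (hmem _).2 ?_
    intro u
    refine Eq.trans ?_ (hx.2 u u.2)
    exact sum_sub_aux s (fun w => if F.Adj u w then x w else 0)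
      (fun w hw => by simp [hx.1 w hw])
  · rintro ⟨x, hx⟩ ⟨y, hy⟩ h
    have h' := congrArg Subtype.val h
    ext u
    by_cases hu : u ∈ s
    · exact congrFun h' ⟨u, hu⟩
    · simp [hx.1 u hu, hy.1 u hu]
  · rintro ⟨y, hy⟩
    replace hy := (hmem y).1 hy
    have hin : ∀ u : (s : Set V), (fun u => if h : u ∈ s then y ⟨u, h⟩ else 0 : V → ℚ) u = y u := by
      rintro ⟨u, hu⟩
      have : u ∈ s := hu
      simp [this]
    refine ⟨⟨fun u => if h : u ∈ s then y ⟨u, h⟩ else 0, fun u hu => by simp [hu], fun u hu => ?_⟩, ?_⟩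
    · refine Eq.trans ?_ (hy ⟨u, hu⟩)
      rw [← sum_sub_aux s]
      · refine Finset.sum_congr rfl fun w _ => ?_
        rw [← hin w]
      · intro w hw; simp [hw]
    · apply Subtype.ext
      funext u
      exact hin u

lemma kerSub_empty {V : Type*} [Fintype V] (F : SimpleGraph V) :
    Module.finrank ℚ (kerSub F ∅) = 0 := by
  have : kerSub F ∅ = ⊥ := by
    rw [eq_bot_iff]
    intro x hx
    rw [Submodule.mem_bot]
    funext u
    exact hx.1 u (by simp)
  rw [this, finrank_bot]

lemma sum_update_aux {V : Type*} [Fintype V] [DecidableEq V] (F : SimpleGraph V) (u v : V) (x : V → ℚ)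
    (c : ℚ) :
    ∑ w, (if F.Adj u w then Function.update x v c w else 0) =
      ∑ w, (if F.Adj u w then x w else 0) + (if F.Adj u v then c - x v else 0) := by
  have : ∀ w, (if F.Adj u w then Function.update x v c w else 0) =
      (if F.Adj u w then x w else 0) + (if w = v then (if F.Adj u v then c - x v else 0) else 0) := by
    intro w
    by_cases h : w = v
    · subst h; by_cases h2 : F.Adj u w <;> simp [h2]
    · simp [h]
  simp [this, Finset.sum_add_distrib]

lemma kerSub_isolated {V : Type*} [Fintype V] [DecidableEq V] (F : SimpleGraph V) (t : Finset V)
    (v : V) (hv : v ∉ t) (h : ∀ u ∈ t, ¬ F.Adj v u) :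
    Module.finrank ℚ (kerSub F (insert v t)) = Module.finrank ℚ (kerSub F t) + 1 := by
  have e : (kerSub F t × ℚ) ≃ₗ[ℚ] kerSub F (insert v t) := by
    refine LinearEquiv.ofBijective
      (((kerSub F t).subtype.coprod (LinearMap.single ℚ (fun _ => ℚ) v)).codRestrict _ ?_) ⟨?_, ?_⟩
    · rintro ⟨⟨x, hx⟩, c⟩
      have hxv := hx.1 v hv
      have : (((kerSub F t).subtype.coprod (LinearMap.single ℚ (fun _ => ℚ) v)) (⟨x, hx⟩, c)) =
          Function.update x v c := by
        funext u
        by_cases hu : u = v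
        · subst hu; simp [hxv]
        · simp [hu]
      rw [this]
      refine ⟨fun u hu => ?_, fun u hu => ?_⟩
      · simp only [Finset.mem_insert, not_or] at hu
        simp [hu.1, hx.1 u hu.2]
      · rw [sum_update_aux]
        rcases Finset.mem_insert.1 hu with rfl | hu
        · simp only [SimpleGraph.irrefl, if_false, add_zero]
          refine Finset.sum_eq_zero fun w _ => ?_
          by_cases hw : w ∈ t
          · simp [h w hw]
          · simp [hx.1 w hw]
        · rw [hx.2 u hu, if_neg (fun h' => h u hu h'.symm), add_zero]
    · rw [← LinearMap.ker_eq_bot, LinearMap.ker_eq_bot']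
      rintro ⟨⟨x, hx⟩, c⟩ h0
      have h1 : x + Pi.single v c = 0 := by simpa using congrArg Subtype.val h0
      have hc : c = 0 := by
        have := congrFun h1 v
        simpa [hx.1 v hv] using this
      subst hc
      simp at h1
      simp [h1]
    · rintro ⟨y, hy⟩
      refine ⟨⟨⟨Function.update y v 0, fun u hu => ?_, fun u hu => ?_⟩, y v⟩, ?_⟩
      · by_cases huv : u = v
        · simp [huv]
        · simp [huv, hy.1 u (by simp [huv, hu])]
      · rw [sum_update_aux, hy.2 u (by simp [hu]), if_neg (fun h' => h u hu h'.symm), add_zero]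
      · apply Subtype.ext
        funext u
        by_cases huv : u = v
        · subst huv; simp
        · simp [huv]
  rw [← e.finrank_eq]
  simp

lemma kerSub_leaf {V : Type*} [Fintype V] [DecidableEq V] (F : SimpleGraph V) (t : Finset V)
    (v w : V) (hv : v ∉ t) (hw : w ∉ t) (hvw : F.Adj v w) (h : ∀ u ∈ t, ¬ F.Adj v u) :
    Module.finrank ℚ (kerSub F (insert v (insert w t))) = Module.finrank ℚ (kerSub F t) := by
  have hne : v ≠ w := hvw.ne
  have hsumv : ∀ x : V → ℚ, (∀ u, u ∉ insert v (insert w t) → x u = 0) →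
      ∑ a, (if F.Adj v a then x a else 0) = x w := by
    intro x hx
    rw [Finset.sum_eq_single w]
    · simp [hvw]
    · intro b _ hb
      by_cases hbt : b ∈ t
      · simp [h b hbt]
      · by_cases hbv : b = v
        · subst hbv; simp
        · simp [hx b (by simp [hb, hbv, hbt])]
    · simp
  have hxw : ∀ x ∈ kerSub F (insert v (insert w t)), x w = 0 := fun x hx => by
    rw [← hsumv x hx.1]; exact hx.2 v (by simp)
  let p : (V → ℚ) →ₗ[ℚ] (V → ℚ) :=
    { toFun := fun x => Function.update x v 0
      map_add' := fun x y => by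
        funext u; by_cases hu : u = v
        · subst hu; simp
        · simp [hu]
      map_smul' := fun c x => by
        funext u; by_cases hu : u = v
        · subst hu; simp
        · simp [hu] }
  have hp : ∀ x, p x = Function.update x v 0 := fun x => rfl
  apply LinearEquiv.finrank_eq
  refine LinearEquiv.ofBijective
      ((p.domRestrict (kerSub F (insert v (insert w t)))).codRestrict (kerSub F t) ?_) ⟨?_, ?_⟩
  · rintro ⟨x, hx⟩
    simp only [LinearMap.domRestrict_apply, hp]
    refine ⟨fun u hu => ?_, fun u hu => ?_⟩
    · by_cases huv : u = v
      · simp [huv]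
      · by_cases huw : u = w
        · subst huw; simp [huv, hxw x hx]
        · simp [huv, hx.1 u (by simp [huv, huw, hu])]
    · rw [sum_update_aux, hx.2 u (by simp [hu]), if_neg (fun h' => h u hu h'.symm), add_zero]
  · rw [← LinearMap.ker_eq_bot, LinearMap.ker_eq_bot']
    rintro ⟨x, hx⟩ h0
    have h1 : Function.update x v 0 = 0 := congrArg Subtype.val h0
    have h2 : ∀ u, u ≠ v → x u = 0 := fun u hu => by simpa [hu] using congrFun h1 u
    apply Subtype.ext
    funext u
    by_cases hu : u = v
    · subst hu
      have h3 := hx.2 w (by simp)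
      rw [Finset.sum_eq_single u] at h3
      · simpa [hvw.symm] using h3
      · intro b _ hb; simp [h2 b hb]
      · simp
    · exact h2 u hu
  · rintro ⟨y, hy⟩
    have hy' : ∀ u, u ∉ insert v (insert w t) → y u = 0 := fun u hu =>
      hy.1 u (fun h' => hu (by simp [h']))
    refine ⟨⟨Function.update y v (- ∑ a, (if F.Adj w a then y a else 0)), fun u hu => ?_,
      fun u hu => ?_⟩, ?_⟩
    · have huv : u ≠ v := by rintro rfl; simp at hu
      simp [huv, hy' u hu]
    · rw [sum_update_aux]
      rcases Finset.mem_insert.1 hu with rfl | hu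
      · rw [hsumv y hy', hy.1 w hw]; simp
      rcases Finset.mem_insert.1 hu with rfl | hu
      · simp [hvw.symm, hy.1 v hv]
      · rw [hy.2 u hu, if_neg (fun h' => h u hu h'.symm), add_zero]
    · apply Subtype.ext
      change Function.update (Function.update y v _) v 0 = y
      rw [Function.update_idem]
      funext u
      by_cases hu : u = v
      · subst hu; simp [hy.1 u hv]
      · simp [hu]

lemma connected_leaf {V : Type*} [DecidableEq V] (F : SimpleGraph V) (t : Finset V)
    (v w : V) (hv : v ∉ t) (hw : w ∈ t) (hvw : F.Adj v w) (h : ∀ u ∈ t, F.Adj v u → u = w) :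
    (F.induce ((insert v t : Finset V) : Set V)).Connected ↔ (F.induce (t : Set V)).Connected := by
  constructor
  · intro hc
    have : Nonempty (t : Set V) := ⟨⟨w, hw⟩⟩
    refine ⟨fun a b => ?_⟩
    let r : ((insert v t : Finset V) : Set V) → (t : Set V) := fun x =>
      if hx : (x : V) ∈ t then ⟨x, hx⟩ else ⟨w, hw⟩
    have hr : ∀ x y, (F.induce ((insert v t : Finset V) : Set V)).Adj x y →
        (F.induce (t : Set V)).Reachable (r x) (r y) := by
      rintro ⟨x, hx⟩ ⟨y, hy⟩ hxy
      replace hxy : F.Adj x y := hxy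
      by_cases h1 : x ∈ t <;> by_cases h2 : y ∈ t <;> simp only [r, h1, h2, dif_pos, dif_neg,
        not_false_eq_true]
      · exact SimpleGraph.Adj.reachable hxy
      · have : y = v := by simpa [h2] using hy
        subst this
        have := h x h1 hxy.symm
        subst this
        rfl
      · have : x = v := by simpa [h1] using hx
        subst this
        have := h y h2 hxy
        subst this
        rfl
      · rfl
    have key : ∀ x y, (F.induce ((insert v t : Finset V) : Set V)).Walk x y →
        (F.induce (t : Set V)).Reachable (r x) (r y) := by
      intro x y p
      induction p with
      | nil => rfl
      | cons hxy _ ih => exact (hr _ _ hxy).trans ih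
    have ha : (a : V) ∈ t := a.2
    have hb : (b : V) ∈ t := b.2
    obtain ⟨p⟩ := hc.preconnected ⟨a, by simp [ha]⟩ ⟨b, by simp [hb]⟩
    have := key _ _ p
    simpa [r, ha, hb] using this
  · intro hc
    have := SimpleGraph.connected_induce_union (G := F) (s := {v}) (t := (t : Set V))
      (v := v) (w := w) (by
        intro a b
        have : a = b := Subtype.ext (a.2.trans b.2.symm)
        subst this; rfl) hc.preconnected rfl hw hvw
    rw [Finset.coe_insert, Set.insert_eq]
    exact this

lemma connected_isolated_s17 {V : Type*} [DecidableEq V] (F : SimpleGraph V) (t : Finset V)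
    (v : V) (hv : v ∉ t) (h : ∀ u ∈ t, ¬ F.Adj v u) :
    (F.induce ((insert v t : Finset V) : Set V)).Connected ↔ t = ∅ := by
  constructor
  · intro hc
    by_contra hne
    obtain ⟨w, hw⟩ := Finset.nonempty_iff_ne_empty.2 hne
    obtain ⟨p⟩ := hc.preconnected ⟨v, by simp⟩ ⟨w, by simp [hw]⟩
    cases p with
    | nil => exact hv hw
    | @cons _ x _ hx _ =>
      have hx' : F.Adj v x := hx
      have : (x : V) ∈ insert v t := x.2
      rcases Finset.mem_insert.1 this with h1 | h1
      · rw [h1] at hx'; exact F.irrefl hx'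
      · exact h _ h1 hx'
  · rintro rfl
    have : Nonempty ((insert v ∅ : Finset V) : Set V) := ⟨⟨v, by simp⟩⟩
    refine ⟨fun a b => ?_⟩
    have : a = b := Subtype.ext (by
      have ha := a.2
      have hb := b.2
      simp at ha hb
      rw [ha, hb])
    subst this; rfl

lemma main_aux_s17 {V : Type*} [Fintype V] [DecidableEq V] (F : SimpleGraph V) (hF : F.IsAcyclic)
    (n : ℕ) : ∀ s : Finset V, s.card = n →
    ∑ t ∈ s.powerset, (-1 : ℤ) ^ t.card * (Module.finrank ℚ (kerSub F t) : ℤ) =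
      if (F.induce (s : Set V)).Connected then (if s.card = 1 then -1 else -2) else 0 := by
  induction n with
  | zero =>
    intro s hs
    rw [Finset.card_eq_zero] at hs
    subst hs
    have : ¬ (F.induce ((∅ : Finset V) : Set V)).Connected := fun hc => by
      obtain ⟨x, hx⟩ := hc.nonempty
      simp at hx
    rw [if_neg this]
    simp [kerSub_empty]
  | succ n ih =>
    intro s hs
    obtain ⟨v, hv, hleaf⟩ := exists_leaf_finset F hF s (Finset.card_pos.1 (by omega))
    obtain ⟨s', hvs', rfl⟩ : ∃ s', v ∉ s' ∧ insert v s' = s :=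
      ⟨s.erase v, by simp, Finset.insert_erase hv⟩
    rw [Finset.card_insert_of_notMem hvs'] at hs
    by_cases hex : ∃ w ∈ s', F.Adj v w
    · obtain ⟨w, hw, hvw⟩ := hex
      have hl : ∀ u ∈ s', F.Adj v u → u = w := fun u hu hvu =>
        hleaf u (by simp [hu]) w (by simp [hw]) hvu hvw
      simp only [connected_leaf F s' v w hvs' hw hvw hl]
      have ihs := ih s' (by omega)
      obtain ⟨t, hwt, rfl⟩ : ∃ t, w ∉ t ∧ insert w t = s' :=
        ⟨s'.erase w, by simp, Finset.insert_erase hw⟩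
      have hvt : v ∉ t := fun h => hvs' (by simp [h])
      have hne := hvw.ne
      have hnadj : ∀ u ∈ t, ¬ F.Adj v u := fun u hu hvu => by
        have := hl u (by simp [hu]) hvu
        subst this
        exact hwt hu
      rw [Finset.sum_powerset_insert hvs', ihs, Finset.sum_powerset_insert hwt]
      have hA : ∑ a ∈ t.powerset, (-1 : ℤ) ^ (insert v a).card *
            (Module.finrank ℚ (kerSub F (insert v a)) : ℤ) +
          ∑ a ∈ t.powerset, (-1 : ℤ) ^ (insert v (insert w a)).card *
            (Module.finrank ℚ (kerSub F (insert v (insert w a))) : ℤ) =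
          - ∑ a ∈ t.powerset, (-1 : ℤ) ^ a.card := by
        rw [← Finset.sum_add_distrib, ← Finset.sum_neg_distrib]
        refine Finset.sum_congr rfl fun a ha => ?_
        rw [Finset.mem_powerset] at ha
        have hva : v ∉ a := fun h => hvt (ha h)
        have hwa : w ∉ a := fun h => hwt (ha h)
        rw [kerSub_isolated F a v hva (fun u hu => hnadj u (ha hu)),
          kerSub_leaf F a v w hva hwa hvw (fun u hu => hnadj u (ha hu)),
          Finset.card_insert_of_notMem (show v ∉ insert w a by simp [hne, hva]),
          Finset.card_insert_of_notMem hva, Finset.card_insert_of_notMem hwa]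
        push_cast
        ring
      rw [hA, Finset.sum_powerset_neg_one_pow_card, Finset.card_insert_of_notMem hvs',
        Finset.card_insert_of_notMem hwt]
      by_cases ht : t = ∅
      · subst ht
        have := (connected_isolated_s17 F ∅ w (by simp) (by simp)).2 rfl
        simp only [this]
        simp
      · have : t.card ≠ 0 := by simpa using ht
        simp [ht]
    · push Not at hex
      simp only [connected_isolated_s17 F s' v hvs' hex]
      rw [Finset.sum_powerset_insert hvs', ← Finset.sum_add_distrib]
      have : ∀ a ∈ s'.powerset, (-1 : ℤ) ^ a.card * (Module.finrank ℚ (kerSub F a) : ℤ) +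
          (-1 : ℤ) ^ (insert v a).card * (Module.finrank ℚ (kerSub F (insert v a)) : ℤ) =
          - (-1 : ℤ) ^ a.card := fun a ha => by
        rw [Finset.mem_powerset] at ha
        have hva : v ∉ a := fun h => hvs' (ha h)
        rw [kerSub_isolated F a v hva (fun u hu => hex u (ha hu)),
          Finset.card_insert_of_notMem hva]
        push_cast
        ring
      rw [Finset.sum_congr rfl this, Finset.sum_neg_distrib, Finset.sum_powerset_neg_one_pow_card,
        Finset.card_insert_of_notMem hvs']
      by_cases ht : s' = ∅
      · subst ht; simp
      · simp [ht]

/-- For any finite forest `F`, `L(F) = ∑_{F' induced subforest of F} (-1)^(N(F)-N(F')) Z(F')`,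
where `Z` is the kernel dimension of the adjacency matrix and `L` is 0 on the empty and
on disconnected forests (i.e. on all non-connected forests), 1 on the one-vertex forest,
and `2 (-1)^(n-1)` on trees with `n ≥ 2` vertices. Induced subforests are indexed by
vertex subsets. -/
theorem L_eq_alternating_sum_kerDim {V : Type*} [Fintype V] [DecidableEq V]
    (F : SimpleGraph V) (hF : F.IsAcyclic) :
    (if F.Connected then
        (if Fintype.card V = 1 then (1 : ℤ) else 2 * (-1) ^ (Fintype.card V - 1))
      else 0) =
      ∑ s : Finset V,
        (-1 : ℤ) ^ (Fintype.card V - s.card) * kerDim (F.induce (↑s : Set V)) := by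
  have hm := main_aux_s17 F hF _ Finset.univ rfl
  have hconn : (F.induce ((Finset.univ : Finset V) : Set V)).Connected ↔ F.Connected := by
    rw [Finset.coe_univ]
    exact (SimpleGraph.induceUnivIso F).connected_iff
  simp only [hconn, Finset.powerset_univ, Finset.card_univ] at hm
  have hs : ∀ s : Finset V,
      (-1 : ℤ) ^ (Fintype.card V - s.card) * kerDim (F.induce (↑s : Set V)) =
      (-1 : ℤ) ^ (Fintype.card V) * ((-1 : ℤ) ^ s.card * (Module.finrank ℚ (kerSub F s) : ℤ)) := by
    intro s
    rw [kerDim_eq_s17, ← mul_assoc, ← pow_add]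
    congr 1
    have := Finset.card_le_univ s
    have h2 : Fintype.card V + s.card = (Fintype.card V - s.card) + 2 * s.card := by omega
    rw [h2, pow_add, pow_mul]
    simp
  rw [Finset.sum_congr rfl (fun s _ => hs s), ← Finset.mul_sum, hm]
  by_cases hc : F.Connected
  · simp only [hc, if_true]
    by_cases h1 : Fintype.card V = 1
    · simp [h1]
    · simp only [h1, if_false]
      have := hc.nonempty
      obtain ⟨m, hm'⟩ := Nat.exists_eq_succ_of_ne_zero (Fintype.card_ne_zero (α := V))
      rw [hm']
      simp [pow_succ]
      ring
  · simp [hc]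
end
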